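/- arXiv:math/0612231 — 3 statements merged into one kernel-verified Lean document; each statement's English description precedes it below -/
import Mathlib

section
/- If Q is a quadric cone in PG(3,t^2) with vertex S lying on the Hermitian surface X, then |Q ∩ X| ≤ 2t^3 + 1. -/
open LinearAlgebra.Projectivization Projectivization Finset

/-- The Hermitian surface in `PG(3,q)`, `q = t²`. -/
def hermSurf (t : ℕ) (F : Type) [Field F] : Set (ℙ F (Fin 4 → F)) :=
  {x | ∑ i : Fin 4, (x.rep i) ^ (t + 1) = 0}

/-- The tangent plane to the Hermitian surface at a point `P`, given by the
Hermitian polarity `∑ xᵢ · (Pᵢ)^t = 0`. -/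
def hermTangentPlane (t : ℕ) (F : Type) [Field F] (P : ℙ F (Fin 4 → F)) :
    Set (ℙ F (Fin 4 → F)) :=
  {x | ∑ i : Fin 4, x.rep i * (P.rep i) ^ t = 0}

/-- The set of projective points of a linear subspace `W` (a plane if
`finrank W = 3`, a line if `finrank W = 2`). -/
def projSet (F : Type) [Field F] (W : Submodule F (Fin 4 → F)) : Set (ℙ F (Fin 4 → F)) :=
  {x | x.submodule ≤ W}

/-- The sesquilinear form `∑ xᵢ σ(yᵢ)`, linear in the first variable. -/
def sesqForm {F : Type} [Field F] (σ : F →+* F) (y : Fin 4 → F) : (Fin 4 → F) →ₗ[F] F where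
  toFun x := ∑ i, x i * σ (y i)
  map_add' x z := by simp [add_mul, Finset.sum_add_distrib]
  map_smul' a x := by simp [Finset.mul_sum, mul_assoc]

section Form

variable {F : Type} [Field F] {σ : F →+* F}

lemma sesqForm_apply (x y : Fin 4 → F) : sesqForm σ y x = ∑ i, x i * σ (y i) := rfl

lemma sesqForm_add_right (x y z : Fin 4 → F) :
    sesqForm σ (y + z) x = sesqForm σ y x + sesqForm σ z x := by
  simp [sesqForm_apply, mul_add, Finset.sum_add_distrib]

lemma sesqForm_smul_right (a : F) (x y : Fin 4 → F) :
    sesqForm σ (a • y) x = σ a * sesqForm σ y x := by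
  simp [sesqForm_apply, Finset.mul_sum, mul_left_comm]

lemma sesqForm_conj (hσ : ∀ a, σ (σ a) = a) (x y : Fin 4 → F) :
    σ (sesqForm σ x y) = sesqForm σ y x := by
  simp [sesqForm_apply, hσ, mul_comm]

lemma sesqForm_self_add_smul (hσ : ∀ a, σ (σ a) = a) {s : Fin 4 → F} (hs : sesqForm σ s s = 0)
    (v : Fin 4 → F) (a : F) :
    sesqForm σ (v + a • s) (v + a • s) =
      sesqForm σ v v + a * sesqForm σ v s + σ (a * sesqForm σ v s) := by
  simp only [sesqForm_add_right, sesqForm_smul_right, map_add, map_smul, map_mul, smul_eq_mul,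
    sesqForm_conj hσ, hs]
  ring

lemma sesqForm_ne_zero {y : Fin 4 → F} (hy : y ≠ 0) :
    sesqForm σ y ≠ 0 := by
  intro h
  apply hy
  ext i
  have := LinearMap.congr_fun h (Pi.single i 1)
  simpa [sesqForm_apply, Pi.single_apply] using this

lemma finrank_ker_sesqForm {y : Fin 4 → F} (hy : y ≠ 0) :
    Module.finrank F (LinearMap.ker (sesqForm σ y)) = 3 := by
  have := Module.Dual.finrank_ker_add_one_of_ne_zero (sesqForm_ne_zero (σ := σ) hy)
  simp at this
  exact this

lemma mem_span_of_ker_sesqForm_le (hσ : ∀ a, σ (σ a) = a) {s v : Fin 4 → F}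
    (h : LinearMap.ker (sesqForm σ s) ≤ LinearMap.ker (sesqForm σ v)) :
    v ∈ Submodule.span F {s} := by
  have h1 : sesqForm σ v ∈ Submodule.span F (Set.range fun _ : Unit => sesqForm σ s) :=
    mem_span_of_iInf_ker_le_ker (by simpa using h)
  rw [Set.range_const, Submodule.mem_span_singleton] at h1
  obtain ⟨a, ha⟩ := h1
  refine Submodule.mem_span_singleton.2 ⟨σ a, ?_⟩
  ext i
  have := LinearMap.congr_fun ha (Pi.single i 1)
  simp [sesqForm_apply, Pi.single_apply] at this
  simpa [hσ] using congrArg σ this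

open Classical in
lemma card_trace_roots_le [Fintype F] {t : ℕ} (ht : 2 ≤ t) (hσt : ∀ a, σ a = a ^ t)
    {c : F} (hc : c ≠ 0) (e : F) :
    (Finset.univ.filter fun a : F => e + a * c + σ (a * c) = 0).card ≤ t := by
  let p : Polynomial F := Polynomial.C e + Polynomial.C c * Polynomial.X
    + Polynomial.C (c ^ t) * Polynomial.X ^ t
  have hcoeff : p.coeff t = c ^ t := by
    have h1 : t ≠ 0 := by omega
    have h2 : t ≠ 1 := by omega
    simp only [p, Polynomial.coeff_add, Polynomial.coeff_C_mul, Polynomial.coeff_C,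
      Polynomial.coeff_X, Polynomial.coeff_X_pow]
    simp [h1, h2.symm]
  have hp : p ≠ 0 := by
    intro h
    rw [h, Polynomial.coeff_zero] at hcoeff
    exact pow_ne_zero t hc hcoeff.symm
  have hdeg : p.natDegree ≤ t := by
    have : 1 ≤ t := by omega
    simp only [p]
    compute_degree!
  refine le_trans ?_ hdeg
  refine Polynomial.card_le_degree_of_subset_roots (p := p) fun a ha => ?_
  have ha' : e + a * c + σ (a * c) = 0 := by simpa using ha
  rw [Polynomial.mem_roots hp, Polynomial.IsRoot.def]
  rw [hσt, mul_pow] at ha'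
  simp only [p, Polynomial.eval_add, Polynomial.eval_mul, Polynomial.eval_C, Polynomial.eval_X,
    Polynomial.eval_pow]
  linear_combination ha'

lemma eq_span_pair {W : Submodule F (Fin 4 → F)} (hW : Module.finrank F W = 2)
    {s v : Fin 4 → F} (hs0 : s ≠ 0) (hs : s ∈ W) (hv : v ∈ W) (hvs : v ∉ Submodule.span F {s}) :
    W = Submodule.span F {s, v} := by
  have hle : Submodule.span F {s, v} ≤ W := by
    rw [Submodule.span_le]
    rintro x (rfl | rfl) <;> assumption
  have hlt : Submodule.span F {s} < Submodule.span F {s, v} := by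
    refine lt_of_le_of_ne (Submodule.span_mono (by simp)) fun h => hvs ?_
    rw [h]
    exact Submodule.subset_span (by simp)
  have h1 := Submodule.finrank_lt_finrank_of_lt hlt
  rw [finrank_span_singleton hs0] at h1
  exact (Submodule.eq_of_le_of_finrank_le hle (by omega)).symm

lemma exists_notMem_span {W : Submodule F (Fin 4 → F)} (hW : Module.finrank F W = 2)
    (s : Fin 4 → F) : ∃ v ∈ W, v ∉ Submodule.span F {s} := by
  by_contra! h
  have h1 := Submodule.finrank_mono (show W ≤ Submodule.span F {s} from h)
  have h2 := finrank_span_le_card (R := F) ({s} : Set (Fin 4 → F))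
  simp at h2
  omega

/-- A line through `s` all of whose points are isotropic and orthogonal to `s`. -/
def IsGeneratorAt (σ : F →+* F) (s : Fin 4 → F) (W : Submodule F (Fin 4 → F)) : Prop :=
  Module.finrank F W = 2 ∧ s ∈ W ∧ W ≤ LinearMap.ker (sesqForm σ s) ∧
    ∀ x ∈ W, sesqForm σ x x = 0

lemma isGeneratorAt_of_mem (hσ : ∀ a, σ (σ a) = a) {W : Submodule F (Fin 4 → F)}
    (hW : Module.finrank F W = 2) {s v : Fin 4 → F} (hs0 : s ≠ 0) (hs : s ∈ W)
    (hv : v ∈ W) (hvs : v ∉ Submodule.span F {s}) (hss : sesqForm σ s s = 0)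
    (hsv : sesqForm σ v s = 0) (hvv : sesqForm σ v v = 0) : IsGeneratorAt σ s W := by
  have hvs' : sesqForm σ s v = 0 := by rw [← sesqForm_conj hσ, hsv, map_zero]
  refine ⟨hW, hs, fun x hx => ?_, fun x hx => ?_⟩ <;>
  · rw [eq_span_pair hW hs0 hs hv hvs, Submodule.mem_span_pair] at hx
    obtain ⟨a, b, rfl⟩ := hx
    simp [sesqForm_add_right, sesqForm_smul_right, hss, hsv, hvs', hvv]

lemma card_generators_le [Fintype F] {t : ℕ} (ht : 2 ≤ t) (hσ : ∀ a, σ (σ a) = a)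
    (hσt : ∀ a, σ a = a ^ t) {s : Fin 4 → F} (hs0 : s ≠ 0)
    (G : Finset (Submodule F (Fin 4 → F))) (hG : ∀ W ∈ G, IsGeneratorAt σ s W) :
    G.card ≤ t + 1 := by
  classical
  by_cases hG1 : G.card ≤ 1
  · omega
  obtain ⟨W₀, hW₀, W₁, hW₁, hne⟩ := Finset.one_lt_card.1 (not_le.1 hG1)
  obtain ⟨hr₀, hs₀, hk₀, hi₀⟩ := hG W₀ hW₀
  obtain ⟨hr₁, hs₁, hk₁, hi₁⟩ := hG W₁ hW₁
  obtain ⟨v, hv, hvs⟩ := exists_notMem_span hr₀ s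
  obtain ⟨w, hw, hws⟩ := exists_notMem_span hr₁ s
  have hspan₀ := eq_span_pair hr₀ hs0 hs₀ hv hvs
  have hspan₁ := eq_span_pair hr₁ hs0 hs₁ hw hws
  have hsup : W₀ ⊔ W₁ = LinearMap.ker (sesqForm σ s) := by
    refine Submodule.eq_of_le_of_finrank_le (sup_le hk₀ hk₁) ?_
    have hlt : W₀ < W₀ ⊔ W₁ := by
      refine lt_of_le_of_ne le_sup_left fun h => hne ?_
      have : W₁ ≤ W₀ := by rw [h]; exact le_sup_right
      exact (Submodule.eq_of_le_of_finrank_le this (by omega)).symm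
    have := Submodule.finrank_lt_finrank_of_lt hlt
    rw [finrank_ker_sesqForm hs0]
    omega
  have hsv : sesqForm σ v s = 0 := by
    rw [← sesqForm_conj hσ, LinearMap.mem_ker.1 (hk₀ hv), map_zero]
  have hd : sesqForm σ w v ≠ 0 := by
    intro hd
    apply hvs
    apply mem_span_of_ker_sesqForm_le hσ
    rw [← hsup, hspan₀, hspan₁, sup_le_iff, Submodule.span_le, Submodule.span_le]
    constructor
    · rintro x (rfl | rfl)
      · exact hsv
      · exact hi₀ _ hv
    · rintro x (rfl | rfl)
      · exact hsv
      · show sesqForm σ v x = 0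
        rw [← sesqForm_conj hσ, hd, map_zero]
  have key : ∀ W ∈ G.erase W₀, ∃ a : F, w + a • v ∈ W := by
    intro W hW
    obtain ⟨hWne, hWG⟩ := Finset.mem_erase.1 hW
    obtain ⟨hr, hs, hk, hi⟩ := hG W hWG
    obtain ⟨u, hu, hus⟩ := exists_notMem_span hr s
    have hu' := hk hu
    rw [← hsup, hspan₀, hspan₁] at hu'
    obtain ⟨x, hx, y, hy, rfl⟩ := Submodule.mem_sup.1 hu'
    obtain ⟨a, b, rfl⟩ := Submodule.mem_span_pair.1 hx
    obtain ⟨c, d, rfl⟩ := Submodule.mem_span_pair.1 hy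
    by_cases hd0 : d = 0
    · exfalso
      apply hWne
      rw [eq_span_pair hr hs0 hs hu hus]
      refine (eq_span_pair hr₀ hs0 hs₀ ?_ hus).symm
      rw [hd0, zero_smul, add_zero]
      exact W₀.add_mem (W₀.add_mem (W₀.smul_mem _ hs₀) (W₀.smul_mem _ hv)) (W₀.smul_mem _ hs₀)
    · refine ⟨d⁻¹ * b, ?_⟩
      have h1 := W.smul_mem d⁻¹ (W.sub_mem hu (W.smul_mem (a + c) hs))
      convert h1 using 1
      ext i
      simp only [Pi.add_apply, Pi.smul_apply, Pi.sub_apply, smul_eq_mul]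
      field_simp
      ring
  choose! f hf using key
  have hcard : (G.erase W₀).card ≤ t := by
    refine le_trans (Finset.card_le_card_of_injOn f ?_ ?_)
      (card_trace_roots_le (σ := σ) ht hσt hd (0 : F))
    · intro W hW
      have h0 := (hG W (Finset.mem_of_mem_erase hW)).2.2.2 _ (hf W hW)
      rw [sesqForm_self_add_smul hσ (hi₀ v hv), hi₁ w hw] at h0
      simpa using h0
    · intro W hW W' hW' heq
      have hnot : w + f W • v ∉ Submodule.span F {s} := by
        intro h
        apply hne
        have hwW : w ∈ W₀ := by
          have h1 : Submodule.span F {s} ≤ W₀ := by simpa using hs₀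
          simpa using W₀.sub_mem (h1 h) (W₀.smul_mem (f W) hv)
        rw [hspan₁]
        exact eq_span_pair hr₀ hs0 hs₀ hwW hws
      obtain ⟨hr, hs, -, -⟩ := hG W (Finset.mem_of_mem_erase hW)
      obtain ⟨hr', hs', -, -⟩ := hG W' (Finset.mem_of_mem_erase hW')
      have hf' := hf W' hW'
      rw [← heq] at hf'
      rw [eq_span_pair hr hs0 hs (hf W hW) hnot, ← eq_span_pair hr' hs0 hs' hf' hnot]
  rw [Finset.card_erase_of_mem hW₀] at hcard
  omega

lemma mem_hermSurf_iff {t : ℕ} (hσt : ∀ a, σ a = a ^ t) (x : ℙ F (Fin 4 → F)) :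
    x ∈ hermSurf t F ↔ sesqForm σ x.rep x.rep = 0 := by
  simp [hermSurf, sesqForm_apply, hσt, pow_succ']

lemma mk_mem_hermSurf_iff {t : ℕ} (hσt : ∀ a, σ a = a ^ t) {y : Fin 4 → F} (hy : y ≠ 0) :
    Projectivization.mk F y hy ∈ hermSurf t F ↔ sesqForm σ y y = 0 := by
  obtain ⟨a, ha⟩ := Projectivization.exists_smul_eq_mk_rep F y hy
  rw [mem_hermSurf_iff hσt, ← ha, Units.smul_def]
  simp [sesqForm_smul_right]

/-- The points other than `S` of a line through `S` that lie on the Hermitian surface are the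
points `v + a s` with `a` a root of the restricted form. -/
lemma ncard_line_inter_le [Fintype F] {t : ℕ} (hσt : ∀ a, σ a = a ^ t)
    (S : ℙ F (Fin 4 → F)) {W : Submodule F (Fin 4 → F)} (hW : Module.finrank F W = 2)
    (hSW : S.rep ∈ W) {v : Fin 4 → F} (hv : v ∈ W) (hvs : v ∉ Submodule.span F {S.rep}) :
    ((projSet F W ∩ hermSurf t F) \ {S}).ncard ≤
      {a : F | sesqForm σ (v + a • S.rep) (v + a • S.rep) = 0}.ncard := by
  have hne : ∀ a : F, v + a • S.rep ≠ 0 := by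
    intro a h
    apply hvs
    rw [eq_neg_of_add_eq_zero_left h]
    exact Submodule.neg_mem _ (Submodule.smul_mem _ _ (Submodule.mem_span_singleton_self _))
  refine le_trans (Set.ncard_le_ncard ?_ (Set.toFinite _))
    (Set.ncard_image_le (f := fun a => Projectivization.mk F (v + a • S.rep) (hne a))
      (Set.toFinite _))
  rintro x ⟨⟨hxW, hxX⟩, hxS⟩
  have hxr : x.rep ∈ W := by
    have h : x.submodule ≤ W := hxW
    rw [Projectivization.submodule_eq] at h
    simpa using h
  rw [eq_span_pair hW S.rep_nonzero hSW hv hvs] at hxr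
  obtain ⟨a, b, hab⟩ := Submodule.mem_span_pair.1 hxr
  have hb : b ≠ 0 := by
    rintro rfl
    apply hxS
    rw [Set.mem_singleton_iff, ← x.mk_rep, ← S.mk_rep, Projectivization.mk_eq_mk_iff']
    exact ⟨a, by simpa using hab⟩
  have hx : Projectivization.mk F (v + (b⁻¹ * a) • S.rep) (hne _) = x := by
    conv_rhs => rw [← x.mk_rep]
    rw [Projectivization.mk_eq_mk_iff']
    refine ⟨b⁻¹, ?_⟩
    rw [← hab, smul_add, smul_smul, smul_smul, inv_mul_cancel₀ hb, one_smul, add_comm]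
  refine ⟨b⁻¹ * a, ?_, hx⟩
  rw [← hx, mk_mem_hermSurf_iff hσt] at hxX
  exact hxX

lemma ncard_line_inter_le_of_not_isGeneratorAt [Fintype F] {t : ℕ} (ht : 2 ≤ t)
    (hσ : ∀ a, σ (σ a) = a) (hσt : ∀ a, σ a = a ^ t)
    {S : ℙ F (Fin 4 → F)} (hS : S ∈ hermSurf t F) {W : Submodule F (Fin 4 → F)}
    (hW : Module.finrank F W = 2) (hSW : S.rep ∈ W) (hgen : ¬ IsGeneratorAt σ S.rep W) :
    ((projSet F W ∩ hermSurf t F) \ {S}).ncard ≤ t := by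
  classical
  obtain ⟨v, hv, hvs⟩ := exists_notMem_span hW S.rep
  rw [mem_hermSurf_iff hσt] at hS
  refine (ncard_line_inter_le hσt S hW hSW hv hvs).trans ?_
  simp only [sesqForm_self_add_smul hσ hS]
  by_cases hc : sesqForm σ v S.rep = 0
  · have hvv : sesqForm σ v v ≠ 0 := fun h =>
      hgen (isGeneratorAt_of_mem hσ hW S.rep_nonzero hSW hv hvs hS hc h)
    simp [hc, hvv]
  · have := card_trace_roots_le (σ := σ) ht hσt hc (sesqForm σ v v)
    rwa [← Set.ncard_coe_finset, Finset.coe_filter_univ] at this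

end Form

lemma exists_involution_of_card_eq_sq {t : ℕ} (ht : IsPrimePow t) (F : Type) [Field F] [Fintype F]
    (hF : Fintype.card F = t ^ 2) :
    ∃ σ : F →+* F, (∀ a, σ a = a ^ t) ∧ ∀ a, σ (σ a) = a := by
  obtain ⟨r, k, hr, hk, rfl⟩ := ht
  have hr' : r.Prime := hr.nat_prime
  have : Fact r.Prime := ⟨hr'⟩
  have : CharP F r := by
    refine charP_of_card_eq_prime_pow (f := k * 2) ?_
    rw [hF, pow_mul]
  refine ⟨iterateFrobenius F r k, fun a => iterateFrobenius_def r k a, fun a => ?_⟩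
  rw [iterateFrobenius_def, iterateFrobenius_def, ← pow_mul, ← sq, ← hF, FiniteField.pow_card]

/-- If `Q` is a quadric cone in `PG(3,t²)` (the union of `q+1 = t²+1` lines through
a vertex `S`) and the vertex `S` lies on the Hermitian surface `X`, then
`|Q ∩ X| ≤ 2t³+1`. -/
theorem cone_vertex_on_surface (t : ℕ) (ht : IsPrimePow t)
    (F : Type) [Field F] [Fintype F] (hF : Fintype.card F = t ^ 2)
    (S : ℙ F (Fin 4 → F)) (hS : S ∈ hermSurf t F)
    (L : Finset (Submodule F (Fin 4 → F))) (hcard : L.card = t ^ 2 + 1)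
    (hL : ∀ W ∈ L, Module.finrank F W = 2 ∧ S.submodule ≤ W)
    (Q : Set (ℙ F (Fin 4 → F))) (hQ : Q = ⋃ W ∈ L, projSet F W) :
    Nat.card ↥(Q ∩ hermSurf t F) ≤ 2 * t ^ 3 + 1 := by
  classical
  obtain ⟨σ, hσt, hσ⟩ := exists_involution_of_card_eq_sq ht F hF
  have ht2 : 2 ≤ t := ht.two_le
  have hfin : Finite (ℙ F (Fin 4 → F)) := inferInstance
  have hmem : ∀ W ∈ L, S.rep ∈ W := by
    intro W hW
    have h := (hL W hW).2
    rw [Projectivization.submodule_eq] at h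
    simpa using h
  have hsub : Q ∩ hermSurf t F ⊆ {S} ∪ ⋃ W ∈ L, (projSet F W ∩ hermSurf t F) \ {S} := by
    rw [hQ]
    rintro x ⟨hxQ, hxX⟩
    obtain ⟨W, hW, hxW⟩ := Set.mem_iUnion₂.1 hxQ
    by_cases hxS : x = S
    · exact Or.inl hxS
    · exact Or.inr (Set.mem_iUnion₂.2 ⟨W, hW, ⟨hxW, hxX⟩, hxS⟩)
  have hle : (Q ∩ hermSurf t F).ncard ≤
      1 + ∑ W ∈ L, ((projSet F W ∩ hermSurf t F) \ {S}).ncard := by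
    refine (Set.ncard_le_ncard hsub (Set.toFinite _)).trans ((Set.ncard_union_le _ _).trans ?_)
    rw [Set.ncard_singleton]
    exact Nat.add_le_add_left (Finset.set_ncard_biUnion_le L _) 1
  have hG : (L.filter (IsGeneratorAt σ S.rep)).card ≤ t + 1 :=
    card_generators_le ht2 hσ hσt S.rep_nonzero _ fun W hW => (Finset.mem_filter.1 hW).2
  have hsum₁ : ∑ W ∈ L with IsGeneratorAt σ S.rep W,
      ((projSet F W ∩ hermSurf t F) \ {S}).ncard ≤
      (L.filter (IsGeneratorAt σ S.rep)).card * t ^ 2 := by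
    refine Finset.sum_le_card_nsmul _ _ _ fun W hW => ?_
    have hWL := (Finset.mem_filter.1 hW).1
    obtain ⟨v, hv, hvs⟩ := exists_notMem_span (hL W hWL).1 S.rep
    refine (ncard_line_inter_le hσt S (hL W hWL).1 (hmem W hWL) hv hvs).trans ?_
    rw [← hF, ← Nat.card_eq_fintype_card]
    exact Set.ncard_le_card _
  have hsum₂ : ∑ W ∈ L with ¬ IsGeneratorAt σ S.rep W,
      ((projSet F W ∩ hermSurf t F) \ {S}).ncard ≤
      (L.filter fun W => ¬ IsGeneratorAt σ S.rep W).card * t := by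
    refine Finset.sum_le_card_nsmul _ _ _ fun W hW => ?_
    obtain ⟨hWL, hgen⟩ := Finset.mem_filter.1 hW
    exact ncard_line_inter_le_of_not_isGeneratorAt ht2 hσ hσt hS (hL W hWL).1 (hmem W hWL) hgen
  have hsplit := Finset.card_filter_add_card_filter_not (s := L) (IsGeneratorAt σ S.rep)
  rw [← Finset.sum_filter_add_sum_filter_not L (IsGeneratorAt σ S.rep)] at hle
  rw [Nat.card_coe_set_eq]
  rw [hcard] at hsplit
  generalize (L.filter (IsGeneratorAt σ S.rep)).card = g at *
  generalize (L.filter fun W => ¬ IsGeneratorAt σ S.rep W).card = n at *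
  have hbound : g * t ^ 2 + n * t ≤ 2 * t ^ 3 := by
    clear hle hsum₁ hsum₂
    zify at hG hsplit ht2 ⊢
    rw [show (n : ℤ) = t ^ 2 + 1 - g by linarith]
    nlinarith [mul_nonneg (sub_nonneg.2 hG)
      (mul_nonneg (by positivity : (0 : ℤ) ≤ t) (by linarith : (0 : ℤ) ≤ t - 1))]
  omega
end

section
/- If Q is an elliptic quadric in PG(3,t^2) (a non-degenerate quadric containing no lines), then |Q ∩ X| ≤ 2t^3 + t^2 + 1, where X is the Hermitian surface. -/
open LinearAlgebra.Projectivization Projectivization Finset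

/-- A homogeneous polynomial of degree two defines a quadratic form. -/
theorem MvPolynomial.IsHomogeneous.exists_quadraticForm {ι R : Type*} [CommRing R]
    {f : MvPolynomial ι R} (hf : f.IsHomogeneous 2) :
    ∃ q : QuadraticForm R (ι → R), ∀ x, q x = MvPolynomial.eval x f := by
  have hmon : ∀ d : ι →₀ ℕ, d.degree = 2 →
      ∃ q : QuadraticForm R (ι → R), ∀ x, q x = d.prod fun i k => x i ^ k := by
    intro d hd
    classical
    have hd0 : d ≠ 0 := by
      rintro rfl
      simp at hd
    obtain ⟨i, hi⟩ := Finsupp.ne_iff.mp hd0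
    have hi' : Finsupp.single i 1 ≤ d := by
      rw [Finsupp.single_le_iff]
      exact Nat.one_le_iff_ne_zero.mpr hi
    obtain ⟨e, rfl⟩ := exists_add_of_le hi'
    have he : e.degree = 1 := by
      rw [map_add, Finsupp.degree_single] at hd
      omega
    have he0 : e ≠ 0 := by
      rintro rfl
      simp at he
    obtain ⟨j, hj⟩ := Finsupp.ne_iff.mp he0
    obtain ⟨c, rfl⟩ := exists_add_of_le
      (Finsupp.single_le_iff.mpr (Nat.one_le_iff_ne_zero.mpr hj) : Finsupp.single j 1 ≤ e)
    rw [map_add, Finsupp.degree_single, Nat.add_eq_left, Finsupp.degree_eq_zero_iff] at he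
    subst he
    rw [add_zero]
    refine ⟨QuadraticMap.linMulLin (LinearMap.proj i) (LinearMap.proj j), fun x => ?_⟩
    rw [Finsupp.prod_add_index' (by simp) (by intros; rw [pow_add])]
    simp
  choose! q hq using hmon
  refine ⟨∑ d ∈ f.support, f.coeff d • q d, fun x => ?_⟩
  rw [MvPolynomial.eval_eq, _root_.sum_apply]
  refine Finset.sum_congr rfl fun d hd => ?_
  have hdeg : d.degree = 2 := by
    rw [Finsupp.degree_eq_weight_one]
    exact hf (MvPolynomial.mem_support_iff.mp hd)
  rw [smul_apply, hq d hdeg, smul_eq_mul]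
  rfl

/-- The `t`-power map is a ring endomorphism of a field of order `t ^ 2`. -/
theorem exists_ringHom_eq_pow_of_card_eq_sq {F : Type*} [Field F] [Fintype F] {t : ℕ}
    (hF : Fintype.card F = t ^ 2) : ∃ σ : F →+* F, ∀ x, σ x = x ^ t := by
  obtain ⟨p, hp⟩ := CharP.exists F
  obtain ⟨n, hprime, hn⟩ := FiniteField.card F p
  have hdvd : t ∣ p ^ (n : ℕ) := by
    rw [← hn, hF]
    exact dvd_pow_self t two_ne_zero
  obtain ⟨k, -, rfl⟩ := (Nat.dvd_prime_pow hprime).mp hdvd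
  have : Fact p.Prime := ⟨hprime⟩
  exact ⟨iterateFrobenius F p k, fun x => iterateFrobenius_def p k x⟩

theorem Matrix.det_eq_zero_of_succ_succ_eq_zero {R : Type*} [CommRing R]
    (G : Matrix (Fin 4) (Fin 4) R) (hG : ∀ i j : Fin 3, G i.succ j.succ = 0) : G.det = 0 := by
  have h11 := hG 0 0
  have h12 := hG 0 1
  have h13 := hG 0 2
  have h21 := hG 1 0
  have h22 := hG 1 1
  have h23 := hG 1 2
  have h31 := hG 2 0
  have h32 := hG 2 1
  have h33 := hG 2 2
  simp only [Fin.reduceSucc, Fin.succ_zero_eq_one, Fin.succ_one_eq_two] at *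
  rw [Matrix.det_succ_row_zero]
  simp [Fin.sum_univ_succ, Matrix.det_fin_three, Fin.succAbove, *]

/-- A sesquilinear form `∑ xᵢ σ(yᵢ)` in dimension four has no three-dimensional totally
isotropic subspace. -/
theorem exists_dotProduct_ne_zero {F : Type*} [Field F] (σ : F →+* F) {A : Fin 3 → Fin 4 → F}
    (hA : LinearIndependent F A) : ∃ i j, A i ⬝ᵥ (σ ∘ A j) ≠ 0 := by
  by_contra! h
  obtain ⟨x, hx⟩ := exists_linearIndependent_cons_of_lt_finrank hA (by simp)
  set N : Matrix (Fin 4) (Fin 4) F := Matrix.of (Fin.cons x A) with hN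
  have hdet : N.det ≠ 0 :=
    ((Matrix.isUnit_iff_isUnit_det N).mp (Matrix.linearIndependent_rows_iff_isUnit.mp hx)).ne_zero
  have hzero : (N * (σ.mapMatrix N).transpose).det = 0 :=
    Matrix.det_eq_zero_of_succ_succ_eq_zero _ fun i j => h i j
  rw [Matrix.det_mul, Matrix.det_transpose, ← RingHom.map_det] at hzero
  exact mul_ne_zero hdet ((map_ne_zero σ).mpr hdet) hzero

/-- A parametrized conic passing through a point of the Hermitian surface at infinity meets the
surface in at most `2 t + 1` further points. -/
theorem card_conic_inter_hermitian_le {F : Type*} [Field F] [Fintype F] [DecidableEq F] {t : ℕ}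
    (hF : Fintype.card F = t ^ 2) {A : Fin 3 → Fin 4 → F} (hA : LinearIndependent F A)
    (hinf : ∑ i, A 2 i ^ (t + 1) = 0) :
    #{s : F | ∑ i, (A 0 + s • A 1 + s ^ 2 • A 2) i ^ (t + 1) = 0} ≤ 2 * t + 1 := by
  obtain ht | ht : t ≤ 2 ∨ 3 ≤ t := by omega
  · calc #{s : F | ∑ i, (A 0 + s • A 1 + s ^ 2 • A 2) i ^ (t + 1) = 0}
        ≤ Fintype.card F := Finset.card_le_univ _
      _ ≤ 2 * t + 1 := by rw [hF]; nlinarith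
  obtain ⟨σ, hσ⟩ := exists_ringHom_eq_pow_of_card_eq_sq hF
  set h : Fin 3 → Fin 3 → F := fun i j => A i ⬝ᵥ (σ ∘ A j) with hh
  have h22 : h 2 2 = 0 := by
    rw [← hinf]
    simp [hh, dotProduct, hσ, pow_succ, mul_comm]
  set p : Polynomial F := ∑ i : Fin 3, ∑ j : Fin 3,
    Polynomial.C (h i j) * Polynomial.X ^ ((i : ℕ) + t * j) with hp
  have hdeg : p.natDegree ≤ 2 * t + 1 := by
    refine Polynomial.natDegree_sum_le_of_forall_le _ _ fun i _ =>
      Polynomial.natDegree_sum_le_of_forall_le _ _ fun j _ => ?_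
    by_cases hij : h i j = 0
    · simp [hij]
    · refine (Polynomial.natDegree_C_mul_X_pow_le _ _).trans ?_
      have : ¬ ((i : ℕ) = 2 ∧ (j : ℕ) = 2) := by
        rintro ⟨hi, hj⟩
        obtain rfl : i = 2 := Fin.ext hi
        obtain rfl : j = 2 := Fin.ext hj
        exact hij h22
      have hi := i.isLt
      have hj := j.isLt
      obtain hj2 | hj2 : (j : ℕ) = 2 ∨ (j : ℕ) ≤ 1 := by omega
      · rw [hj2]; omega
      · nlinarith
  have hne : p ≠ 0 := by
    obtain ⟨a, b, hab⟩ := exists_dotProduct_ne_zero σ hA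
    intro h0
    apply hab
    have hcoeff : p.coeff ((a : ℕ) + t * b) = h a b := by
      simp only [hp, Polynomial.finsetSum_coeff, Polynomial.coeff_C_mul_X_pow]
      rw [Finset.sum_eq_single a, Finset.sum_eq_single b]
      · simp
      · intro j _ hj
        rw [if_neg]
        intro he
        have : t * (b : ℕ) = t * j := by omega
        exact hj (Fin.ext (Nat.eq_of_mul_eq_mul_left (by omega) this).symm)
      · simp
      · intro i _ hi
        refine Finset.sum_eq_zero fun j _ => if_neg fun he => hi (Fin.ext ?_)
        have := congrArg (· % t) he
        simp only [Nat.add_mul_mod_self_left] at this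
        rw [Nat.mod_eq_of_lt (by omega), Nat.mod_eq_of_lt (by omega)] at this
        exact this.symm
      · simp
    rw [h0] at hcoeff
    simpa using hcoeff.symm
  refine le_trans (Finset.card_le_card ?_) ((Multiset.toFinset_card_le p.roots).trans
    ((Polynomial.card_roots' p).trans hdeg))
  intro s hs
  rw [Finset.mem_filter_univ] at hs
  have hpow : ∀ x y z : F,
      (x + s * y + s ^ 2 * z) ^ t = x ^ t + s ^ t * y ^ t + (s ^ t) ^ 2 * z ^ t := by
    intro x y z
    simp only [← hσ, map_add, map_mul, map_pow]
  rw [Multiset.mem_toFinset, Polynomial.mem_roots hne, Polynomial.IsRoot, ← hs]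
  simp only [hp, hh, dotProduct, Polynomial.eval_finsetSum, Polynomial.eval_mul,
    Polynomial.eval_C, Polynomial.eval_pow, Polynomial.eval_X, pow_succ _ t, ← hσ]
  simp only [Fin.sum_univ_three, Fin.sum_univ_four, Function.comp, Pi.add_apply, Pi.smul_apply,
    smul_eq_mul, hσ, hpow, Fin.val_zero, Fin.val_one, Fin.val_two]
  ring

/-- A vector in the kernel of a nonzero functional extends to a basis adapted to the kernel. -/
theorem exists_linearIndependent_adapted {F V : Type*} [Field F] [AddCommGroup V] [Module F V]
    (hV : Module.finrank F V = 4) {φ : V →ₗ[F] F} (hφ : φ ≠ 0) {v : V} (hv : v ≠ 0)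
    (hφv : φ v = 0) :
    ∃ w e' e, φ w = 1 ∧ φ e' = 0 ∧ φ e = 0 ∧ LinearIndependent F ![w, e', e, v] := by
  have : FiniteDimensional F V := .of_finrank_pos (by omega)
  have hker : Module.finrank F (LinearMap.ker φ) = 3 := by
    have := Module.Dual.finrank_ker_add_one_of_ne_zero hφ
    omega
  obtain ⟨w, hw⟩ := LinearMap.surjective hφ 1
  let v' : LinearMap.ker φ := ⟨v, hφv⟩
  have h1 : LinearIndependent F ![v'] := by
    refine LinearIndependent.of_subsingleton (i := 0) ?_
    simpa [v', Subtype.ext_iff] using hv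
  obtain ⟨e, h2⟩ := exists_linearIndependent_cons_of_lt_finrank h1 (by omega)
  obtain ⟨e', h3⟩ := exists_linearIndependent_cons_of_lt_finrank h2 (by omega)
  have h4 := h3.map' (LinearMap.ker φ).subtype (Submodule.ker_subtype _)
  have h5 : ⇑(LinearMap.ker φ).subtype ∘ (Fin.cons e' (Fin.cons e ![v'])) =
      ![(e' : V), (e : V), v] := by
    ext i
    fin_cases i <;> rfl
  refine ⟨w, e', e, hw, e'.2, e.2, ?_⟩
  refine linearIndependent_finCons.mpr ⟨h5 ▸ h4, fun hmem => ?_⟩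
  have hle : Submodule.span F (Set.range ![(e' : V), (e : V), v]) ≤ LinearMap.ker φ := by
    rw [Submodule.span_le]
    rintro _ ⟨i, rfl⟩
    fin_cases i
    exacts [e'.2, e.2, hφv]
  have := hle hmem
  rw [LinearMap.mem_ker, hw] at this
  exact one_ne_zero this

/-- If a quadratic surface has a nonsingular point `v` on the Hermitian surface and contains no
line through `v`, then counting along the planes through a tangent line at `v` bounds its
intersection with the Hermitian surface. -/
theorem ncard_quadric_inter_hermitian_le {F : Type*} [Field F] [Fintype F] {t : ℕ}
    (hF : Fintype.card F = t ^ 2) (q : QuadraticForm F (Fin 4 → F)) {v : Fin 4 → F} (hv : v ≠ 0)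
    (hqv : q v = 0) (hherm : ∑ i, v i ^ (t + 1) = 0) (hpolar : q.polarBilin v ≠ 0)
    (hline : ∀ u, q u = 0 → q.polarBilin v u = 0 → ∃ c : F, u = c • v) :
    {x : ℙ F (Fin 4 → F) | q x.rep = 0 ∧ ∑ i, x.rep i ^ (t + 1) = 0}.ncard ≤
      2 * t ^ 3 + t ^ 2 + 1 := by
  classical
  set φ := q.polarBilin v with hφ
  have hadd : ∀ x y, q (x + y) = q x + q y + q.polarBilin x y := fun x y =>
    QuadraticMap.map_add q x y
  have hφv : φ v = 0 := by
    simp [hφ, QuadraticMap.polar_self, hqv]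
  have hqav : ∀ (a : F) x, q (x + a • v) = q x + a * φ x := by
    intro a x
    have hsymm : q.polarBilin x v = φ x := QuadraticMap.polar_comm q x v
    rw [hadd, QuadraticMap.map_smul, hqv, map_smul, hsymm]
    simp
  obtain ⟨w, e', e, hw, he', he, hind⟩ :=
    exists_linearIndependent_adapted (by simp) hpolar hv hφv
  rw [Fintype.linearIndependent_iff] at hind
  simp only [Fin.sum_univ_four, Matrix.cons_val] at hind
  have hqe : q e ≠ 0 := by
    intro hq0
    obtain ⟨c, hc⟩ := hline e hq0 he
    have := hind ![0, 0, 1, -c] (by simp [hc]) 2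
    simp at this
  let D : F → F → Fin 4 → F := fun r s => w + r • e' + s • e
  let pt : F → F → Fin 4 → F := fun r s => D r s + (-q (D r s)) • v
  have hφpt : ∀ r s, φ (pt r s) = 1 := by
    intro r s
    simp [pt, D, hw, he', he, hφv]
  have hpt0 : ∀ r s, pt r s ≠ 0 := by
    intro r s h0
    have := hφpt r s
    rw [h0, map_zero] at this
    exact zero_ne_one this
  let A : F → Fin 3 → Fin 4 → F := fun r =>
    ![w + r • e' + (-q (w + r • e')) • v, e + (-q.polarBilin (w + r • e') e) • v, (-q e) • v]
  have hptA : ∀ r s, pt r s = A r 0 + s • A r 1 + s ^ 2 • A r 2 := by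
    intro r s
    have hq : q (D r s) = q (w + r • e') + s ^ 2 * q e + s * q.polarBilin (w + r • e') e := by
      simp only [D]
      rw [hadd, QuadraticMap.map_smul, map_smul, smul_eq_mul, smul_eq_mul, sq]
    simp only [pt, hq, A, D, Matrix.cons_val]
    module
  have hA : ∀ r, LinearIndependent F (A r) := by
    intro r
    rw [Fintype.linearIndependent_iff]
    intro g hg
    simp only [Fin.sum_univ_three, A, Matrix.cons_val] at hg
    have key := hind ![g 0, g 0 * r, g 1, -g 0 * q (w + r • e') -
      g 1 * q.polarBilin (w + r • e') e - g 2 * q e] (by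
        rw [← hg]
        simp only [Matrix.cons_val]
        module)
    have h0 : g 0 = 0 := key 0
    have h1 : g 1 = 0 := key 2
    have h2 : -g 0 * q (w + r • e') - g 1 * q.polarBilin (w + r • e') e - g 2 * q e = 0 := key 3
    have h3 : g 2 = 0 := by simpa [h0, h1, hqe] using h2
    intro i
    fin_cases i <;> assumption
  have hinf : ∀ r, ∑ i, A r 2 i ^ (t + 1) = 0 := by
    intro r
    simp only [A, Matrix.cons_val, Pi.smul_apply, smul_eq_mul, mul_pow]
    rw [← Finset.mul_sum, hherm, mul_zero]
  let R : Finset (Σ _ : F, F) := Finset.univ.sigma fun r =>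
    {s : F | ∑ i, (A r 0 + s • A r 1 + s ^ 2 • A r 2) i ^ (t + 1) = 0}
  have hR : #R ≤ t ^ 2 * (2 * t + 1) := by
    rw [Finset.card_sigma, ← hF, ← smul_eq_mul, ← Finset.card_univ]
    exact Finset.sum_le_card_nsmul _ _ _ fun r _ =>
      card_conic_inter_hermitian_le hF (hA r) (hinf r)
  let y : (Σ _ : F, F) → ℙ F (Fin 4 → F) := fun z => Projectivization.mk F _ (hpt0 z.1 z.2)
  have hsub : {x : ℙ F (Fin 4 → F) | q x.rep = 0 ∧ ∑ i, x.rep i ^ (t + 1) = 0} ⊆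
      insert (Projectivization.mk F v hv) (R.image y : Finset (ℙ F (Fin 4 → F))) := by
    rintro x ⟨hqx, hx⟩
    by_cases hφx : φ x.rep = 0
    · left
      obtain ⟨c, hc⟩ := hline _ hqx hφx
      rw [← x.mk_rep, Projectivization.mk_eq_mk_iff']
      exact ⟨c, hc.symm⟩
    right
    set u := (φ x.rep)⁻¹ • x.rep with hu
    have hφu : φ u = 1 := by simp [hu, hφx]
    have hqu : q u = 0 := by simp [hu, QuadraticMap.map_smul, hqx]
    have hux : ∑ i, u i ^ (t + 1) = 0 := by
      simp only [hu, Pi.smul_apply, smul_eq_mul, mul_pow]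
      rw [← Finset.mul_sum, hx, mul_zero]
    have hspan : u ∈ Submodule.span F (Set.range ![w, e', e, v]) := by
      have hli : LinearIndependent F ![w, e', e, v] := by
        rw [Fintype.linearIndependent_iff]
        simpa only [Fin.sum_univ_four, Matrix.cons_val] using hind
      rw [hli.span_eq_top_of_card_eq_finrank (by simp)]
      trivial
    obtain ⟨c, hc⟩ := (Submodule.mem_span_range_iff_exists_fun F).mp hspan
    simp only [Fin.sum_univ_four, Matrix.cons_val] at hc
    have hc0 : c 0 = 1 := by
      rw [← hφu, ← hc]
      simp [hw, he', he, hφv]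
    have hcu : u = D (c 1) (c 2) + c 3 • v := by
      rw [← hc, hc0, one_smul]
    have hφD : φ (D (c 1) (c 2)) = 1 := by simp [D, hw, he', he]
    have hc3 : c 3 = -q (D (c 1) (c 2)) := by
      rw [hcu, hqav, hφD] at hqu
      linear_combination hqu
    have hupt : u = pt (c 1) (c 2) := by
      rw [hcu, hc3]
    rw [Finset.mem_coe, Finset.mem_image]
    refine ⟨⟨c 1, c 2⟩, ?_, ?_⟩
    · rw [Finset.mem_sigma, Finset.mem_filter_univ, ← hptA, ← hupt]
      exact ⟨Finset.mem_univ _, hux⟩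
    · conv_rhs => rw [← x.mk_rep]
      rw [Projectivization.mk_eq_mk_iff']
      exact ⟨_, hu.symm.trans hupt⟩
  calc _ ≤ (insert (Projectivization.mk F v hv) (R.image y : Set (ℙ F (Fin 4 → F)))).ncard :=
        Set.ncard_le_ncard (by simpa using hsub) ((Finset.finite_toSet _).insert _)
    _ ≤ ((R.image y : Finset (ℙ F (Fin 4 → F))) : Set (ℙ F (Fin 4 → F))).ncard + 1 := by
        rw [Finset.coe_image]
        exact Set.ncard_insert_le _ _
    _ ≤ #R + 1 := by
        rw [Set.ncard_coe_finset]
        exact Nat.add_le_add_right Finset.card_image_le 1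
    _ ≤ 2 * t ^ 3 + t ^ 2 + 1 := by nlinarith

theorem projSet_span_pair_subset {F : Type} [Field F] (q : QuadraticForm F (Fin 4 → F))
    {v u : Fin 4 → F} (hv : q v = 0) (hu : q u = 0) (hvu : q.polarBilin v u = 0) :
    projSet F (Submodule.span F {v, u}) ⊆ {x | q x.rep = 0} := by
  intro x hx
  have hmem : x.rep ∈ Submodule.span F {v, u} := by
    apply show x.submodule ≤ _ from hx
    rw [Projectivization.submodule_eq]
    exact Submodule.mem_span_singleton_self _
  obtain ⟨a, b, hab⟩ := Submodule.mem_span_pair.mp hmem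
  have hpolar : QuadraticMap.polar q (a • v) (b • u) = 0 := by
    change q.polarBilin (a • v) (b • u) = 0
    rw [map_smul, map_smul, LinearMap.smul_apply, hvu, smul_zero, smul_zero]
  change q x.rep = 0
  rw [← hab, QuadraticMap.map_add q, hpolar, QuadraticMap.map_smul, QuadraticMap.map_smul, hv, hu]
  simp

/-- If `Q` is an elliptic quadric in `PG(3,t²)` — the zero set of a nonzero quadratic
form, having `q²+1 = t⁴+1` points and containing no line — then
`|Q ∩ X| ≤ 2t³+t²+1` for the Hermitian surface `X`. -/
theorem elliptic_quadric_bound (t : ℕ) (ht : IsPrimePow t)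
    (F : Type) [Field F] [Fintype F] (hF : Fintype.card F = t ^ 2)
    (f : MvPolynomial (Fin 4) F) (hf : f.IsHomogeneous 2) (hf0 : f ≠ 0)
    (Q : Set (ℙ F (Fin 4 → F))) (hQ : Q = {x | MvPolynomial.eval x.rep f = 0})
    (hcard : Nat.card ↥Q = t ^ 4 + 1)
    (hnoline : ¬ ∃ W : Submodule F (Fin 4 → F),
      Module.finrank F W = 2 ∧ projSet F W ⊆ Q) :
    Nat.card ↥(Q ∩ hermSurf t F) ≤ 2 * t ^ 3 + t ^ 2 + 1 := by

  obtain ⟨q, hq⟩ := hf.exists_quadraticForm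
  have hQq : Q = {x | q x.rep = 0} := by simp only [hQ, hq]
  have hset : Q ∩ hermSurf t F =
      {x : ℙ F (Fin 4 → F) | q x.rep = 0 ∧ ∑ i, x.rep i ^ (t + 1) = 0} := by
    rw [hQq]
    rfl
  rw [Nat.card_coe_set_eq, hset]
  obtain hempty | ⟨P, hqP, hP⟩ := Set.eq_empty_or_nonempty
    {x : ℙ F (Fin 4 → F) | q x.rep = 0 ∧ ∑ i, x.rep i ^ (t + 1) = 0}
  · simp [hempty]
  have hline : ∀ u, q u = 0 → q.polarBilin P.rep u = 0 → ∃ c : F, u = c • P.rep := by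
    intro u hu hPu
    by_contra! hne
    have hli : LinearIndependent F ![P.rep, u] :=
      (LinearIndependent.pair_iff' P.rep_nonzero).mpr fun c hc => hne c hc.symm
    refine hnoline ⟨Submodule.span F {P.rep, u}, ?_, ?_⟩
    · rw [← Matrix.range_cons_cons_empty P.rep u ![], finrank_span_eq_card hli, Fintype.card_fin]
    · rw [hQq]
      exact projSet_span_pair_subset q hqP hu hPu
  by_cases hpolar : q.polarBilin P.rep = 0
  · refine (Set.ncard_le_ncard (t := {P}) ?_).trans (by rw [Set.ncard_singleton]; omega)
    rintro x ⟨hqx, -⟩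
    obtain ⟨c, hc⟩ := hline _ hqx (by rw [hpolar, LinearMap.zero_apply])
    rw [Set.mem_singleton_iff, ← x.mk_rep, ← P.mk_rep, Projectivization.mk_eq_mk_iff']
    exact ⟨c, hc.symm⟩
  · exact ncard_quadric_inter_hermitian_le hF q P.rep_nonzero hqP hP hpolar hline
end

section
/- For every quadric Q in PG(3,t^2) and the non-degenerate Hermitian surface X, either |Q ∩ X| = 2(t^3 + t^2 - t) + t + 1, or |Q ∩ X| ≤ 2t^3 + t^2 + 1. In particular |Q ∩ X| ≤ 2(t^3 + t^2 - t) + t + 1. -/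
open LinearAlgebra.Projectivization Projectivization Finset

section HermitianForm

variable {F : Type} [Field F]

/-- The sesquilinear form `∑ xᵢ yᵢᵗ` on `F⁴`. -/
def herm (t : ℕ) (x y : Fin 4 → F) : F := ∑ i, x i * y i ^ t

/-- `F` is a finite field with `t²` elements for which `a ↦ aᵗ` is additive. -/
class IsHermitianField (t : ℕ) (F : Type) [Field F] [Fintype F] : Prop where
  two_le : 2 ≤ t
  card_eq : Fintype.card F = t ^ 2
  add_pow_eq : ∀ a b : F, (a + b) ^ t = a ^ t + b ^ t

lemma isHermitianField_of_isPrimePow [Fintype F] {t : ℕ} (ht : IsPrimePow t)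
    (hF : Fintype.card F = t ^ 2) : IsHermitianField t F := by
  refine ⟨ht.two_le, hF, fun a b => ?_⟩
  obtain ⟨p, hp⟩ := CharP.exists F
  obtain ⟨n, hpp, hn⟩ := FiniteField.card F p
  obtain ⟨r, k, hr, hk, rfl⟩ := ht
  have : p = r := by
    have h1 : p ∣ (r ^ k) ^ 2 := by
      rw [← hF, hn]; exact dvd_pow_self _ n.ne_zero
    have h2 := hpp.dvd_of_dvd_pow (hpp.dvd_of_dvd_pow h1)
    exact (Nat.prime_dvd_prime_iff_eq hpp hr.nat_prime).1 h2
  subst this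
  have : Fact p.Prime := ⟨hpp⟩
  exact add_pow_char_pow a b p k

variable {t : ℕ}

@[simp] lemma herm_add_left (x y z : Fin 4 → F) : herm t (x + y) z = herm t x z + herm t y z := by
  simp [herm, add_mul, Finset.sum_add_distrib]

@[simp] lemma herm_smul_left (c : F) (x z : Fin 4 → F) : herm t (c • x) z = c * herm t x z := by
  simp [herm, mul_assoc, Finset.mul_sum]

@[simp] lemma herm_neg_left (x z : Fin 4 → F) : herm t (-x) z = -herm t x z := by
  simp [herm]

@[simp] lemma herm_smul_right (c : F) (x z : Fin 4 → F) : herm t x (c • z) = c ^ t * herm t x z := by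
  simp only [herm, Pi.smul_apply, smul_eq_mul, mul_pow, Finset.mul_sum]
  exact Finset.sum_congr rfl fun _ _ => by ring

lemma herm_self_eq (x : Fin 4 → F) : herm t x x = ∑ i, x i ^ (t + 1) := by
  simp [herm, pow_succ']

@[simp] lemma herm_zero_left (z : Fin 4 → F) : herm t 0 z = 0 := by simp [herm]

variable [Fintype F] [hF : IsHermitianField t F]

include hF

@[simp] lemma herm_add_right (x y z : Fin 4 → F) : herm t x (y + z) = herm t x y + herm t x z := by
  simp [herm, IsHermitianField.add_pow_eq (t := t), mul_add, Finset.sum_add_distrib]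

omit hF in
lemma pos_of_isHermitianField [hF : IsHermitianField t F] : 0 < t :=
  lt_of_lt_of_le two_pos hF.two_le

lemma zero_pow_t : (0 : F) ^ t = 0 := zero_pow (pos_of_isHermitianField (F := F)).ne'

@[simp] lemma herm_zero_right (z : Fin 4 → F) : herm t z 0 = 0 := by
  simp [herm, zero_pow_t]

lemma pow_pow_t (a : F) : (a ^ t) ^ t = a := by
  rw [← pow_mul, ← sq, ← hF.card_eq, FiniteField.pow_card]

lemma sum_pow_t {ι : Type*} (s : Finset ι) (g : ι → F) : (∑ i ∈ s, g i) ^ t = ∑ i ∈ s, g i ^ t := by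
  classical
  induction s using Finset.induction_on with
  | empty => simp [zero_pow_t]
  | insert a s ha ih => rw [sum_insert ha, sum_insert ha, hF.add_pow_eq, ih]

lemma herm_pow (x y : Fin 4 → F) : herm t x y ^ t = herm t y x := by
  unfold herm
  rw [sum_pow_t]
  exact sum_congr rfl fun i _ => by rw [mul_pow, pow_pow_t, mul_comm]

lemma herm_eq_zero_comm {x y : Fin 4 → F} : herm t x y = 0 ↔ herm t y x = 0 := by
  constructor <;> intro h <;> rw [← herm_pow, h, zero_pow_t]

lemma exists_herm_eq (φ : (Fin 4 → F) →ₗ[F] F) : ∃ R, ∀ v, φ v = herm t v R := by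
  refine ⟨fun i => φ (Pi.single i 1) ^ t, fun v => ?_⟩
  simp only [herm, pow_pow_t]
  rw [LinearMap.pi_apply_eq_sum_univ φ v]
  refine sum_congr rfl fun i _ => ?_
  rw [smul_eq_mul]
  congr 2
  ext j
  simp [Pi.single_apply, eq_comm]

lemma eq_zero_of_herm {y : Fin 4 → F} (h : ∀ x, herm t x y = 0) : y = 0 := by
  ext i
  have := h (Pi.single i 1)
  simp only [herm, Pi.single_apply, ite_mul, one_mul, zero_mul, sum_ite_eq', mem_univ,
    if_true] at this
  simpa using pow_eq_zero_iff (pos_of_isHermitianField (F := F)).ne' |>.1 this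

/-- Two vectors orthogonal to a common hyperplane are linearly dependent. -/
lemma exists_dependent {A B D : Fin 4 → F}
    (h : ∀ v, ∃ (d : F) (w : Fin 4 → F), v = w + d • D ∧ herm t w A = 0 ∧ herm t w B = 0) :
    ∃ a b : F, (a ≠ 0 ∨ b ≠ 0) ∧ a • A + b • B = 0 := by
  by_cases h0 : herm t D A = 0 ∧ herm t D B = 0
  · refine ⟨1, 0, by simp, ?_⟩
    have : A = 0 := eq_zero_of_herm (t := t) fun x => by
      obtain ⟨d, w, rfl, hA, -⟩ := h x
      simp [herm_add_left, herm_smul_left, hA, h0.1]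
    simp [this]
  · refine ⟨herm t B D, -herm t A D, ?_, ?_⟩
    · by_contra hc
      push Not at hc
      exact h0 ⟨herm_eq_zero_comm.1 (neg_eq_zero.1 hc.2), herm_eq_zero_comm.1 hc.1⟩
    · refine eq_zero_of_herm (t := t) fun x => ?_
      obtain ⟨d, w, rfl, hA, hB⟩ := h x
      have hneg : (-herm t A D) ^ t = -herm t D A := by
        rw [← herm_pow A D, eq_neg_iff_add_eq_zero, ← hF.add_pow_eq, neg_add_cancel, zero_pow_t]
      simp only [herm_add_left, herm_smul_left, herm_add_right, herm_smul_right, hA, hB, herm_pow,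
        hneg]
      ring

/-- The linear functional `x ↦ herm t x R`. -/
def hermLeft (t : ℕ) {F : Type} [Field F] (R : Fin 4 → F) : (Fin 4 → F) →ₗ[F] F where
  toFun x := herm t x R
  map_add' x y := herm_add_left x y R
  map_smul' c x := herm_smul_left c x R

end HermitianForm

section Frames

variable {F : Type} [Field F]

lemma exists_basis_ker_inf_ker (φ ψ : (Fin 4 → F) →ₗ[F] F) {u w : Fin 4 → F} (h1 : φ u = 1)
    (h2 : ψ u = 0) (h3 : φ w = 0) (h4 : ψ w = 1) :
    ∃ A B : Fin 4 → F, φ A = 0 ∧ ψ A = 0 ∧ φ B = 0 ∧ ψ B = 0 ∧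
      (∀ a b : F, a • A + b • B = 0 → a = 0 ∧ b = 0) ∧
      ∀ v, φ v = 0 → ψ v = 0 → ∃ a b : F, v = a • A + b • B := by
  have hsurj : LinearMap.range (φ.prod ψ) = ⊤ := by
    rw [LinearMap.range_eq_top]
    rintro ⟨a, b⟩
    exact ⟨a • u + b • w, by simp [h1, h2, h3, h4]⟩
  have hdim : Module.finrank F (LinearMap.ker (φ.prod ψ)) = 2 := by
    have := LinearMap.finrank_range_add_finrank_ker (φ.prod ψ)
    rw [hsurj] at this
    simp at this
    omega
  let b := Module.finBasisOfFinrankEq F _ hdim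
  have hk : ∀ i, φ (b i) = 0 ∧ ψ (b i) = 0 := fun i => by
    have := (b i).2
    simpa [LinearMap.mem_ker] using this
  refine ⟨b 0, b 1, (hk 0).1, (hk 0).2, (hk 1).1, (hk 1).2, fun x y hxy => ?_, fun v hv hv' => ?_⟩
  · have h := Fintype.linearIndependent_iff.1 b.linearIndependent ![x, y]
      (by ext1; simpa using hxy)
    exact ⟨h 0, h 1⟩
  · have hm : v ∈ LinearMap.ker (φ.prod ψ) := by simp [hv, hv']
    refine ⟨b.repr ⟨v, hm⟩ 0, b.repr ⟨v, hm⟩ 1, ?_⟩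
    have := congrArg Subtype.val (b.sum_repr ⟨v, hm⟩)
    rw [Fin.sum_univ_two] at this
    exact this.symm

/-- The four vectors span `F⁴`. -/
def IsFrame (e0 e1 e2 e3 : Fin 4 → F) : Prop :=
  ∀ v, ∃ a b c d : F, v = a • e0 + b • e1 + c • e2 + d • e3

lemma IsFrame.exists_basis {e0 e1 e2 e3 : Fin 4 → F} (h : IsFrame e0 e1 e2 e3) :
    ∃ b : Module.Basis (Fin 4) F (Fin 4 → F), b 0 = e0 ∧ b 1 = e1 ∧ b 2 = e2 ∧ b 3 = e3 := by
  have htop : ⊤ ≤ Submodule.span F (Set.range ![e0, e1, e2, e3]) := fun v _ => by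
    obtain ⟨a, b, c, d, rfl⟩ := h v
    rw [Submodule.mem_span_range_iff_exists_fun]
    exact ⟨![a, b, c, d], by simp [Fin.sum_univ_four]⟩
  refine ⟨basisOfTopLeSpanOfCardEqFinrank _ htop (by simp), ?_⟩
  simp

lemma IsFrame.indep {e0 e1 e2 e3 : Fin 4 → F} (h : IsFrame e0 e1 e2 e3) {a b c d : F}
    (h0 : a • e0 + b • e1 + c • e2 + d • e3 = 0) : a = 0 ∧ b = 0 ∧ c = 0 ∧ d = 0 := by
  obtain ⟨B, rfl, rfl, rfl, rfl⟩ := h.exists_basis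
  have := Fintype.linearIndependent_iff.1 B.linearIndependent ![a, b, c, d]
      (by simpa [Fin.sum_univ_four] using h0)
  exact ⟨this 0, this 1, this 2, this 3⟩

end Frames

section ProjectivePoints

variable {F : Type} [Field F]

/-- The number of projective points whose representative satisfies `D`. -/
noncomputable def npts (D : (Fin 4 → F) → Prop) : ℕ :=
  {x : ℙ F (Fin 4 → F) | D x.rep}.ncard

variable [Fintype F] {D D₁ D₂ : (Fin 4 → F) → Prop}

lemma finite_points (S : Set (ℙ F (Fin 4 → F))) : S.Finite := by
  have : Finite (ℙ F (Fin 4 → F)) := Quotient.finite _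
  exact S.toFinite

lemma npts_mono (h : ∀ v, v ≠ 0 → D₁ v → D₂ v) : npts D₁ ≤ npts D₂ :=
  Set.ncard_le_ncard (fun x hx => h _ x.rep_nonzero hx) (finite_points _)

lemma npts_or_add_npts_and (D₁ D₂ : (Fin 4 → F) → Prop) :
    npts (fun v => D₁ v ∨ D₂ v) + npts (fun v => D₁ v ∧ D₂ v) = npts D₁ + npts D₂ :=
  Set.ncard_union_add_ncard_inter _ _ (finite_points _) (finite_points _)

lemma npts_le_add (h : ∀ v, v ≠ 0 → D v → D₁ v ∨ D₂ v) : npts D ≤ npts D₁ + npts D₂ := by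
  have := npts_or_add_npts_and D₁ D₂
  have := npts_mono h
  omega

omit [Fintype F] in
lemma npts_le_card {ι : Type} (s : Finset ι) (p : ι → Fin 4 → F)
    (h : ∀ v, v ≠ 0 → D v → ∃ i ∈ s, ∃ c : F, c ≠ 0 ∧ c • v = p i) : npts D ≤ s.card := by
  obtain hι | hι := isEmpty_or_nonempty ι
  · have : {x : ℙ F (Fin 4 → F) | D x.rep} = ∅ := by
      ext x
      simp only [Set.mem_ofPred_eq, Set.mem_empty_iff_false, iff_false]
      exact fun hx => isEmptyElim (h _ x.rep_nonzero hx).choose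
    rw [npts, this, Set.ncard_empty]
    exact Nat.zero_le _
  choose! i hi c hc hp using h
  rw [← Set.ncard_coe_finset s]
  refine Set.ncard_le_ncard_of_injOn (fun x => i x.rep)
    (fun x hx => hi _ x.rep_nonzero hx) ?_ s.finite_toSet
  intro x hx y hy hxy
  have h1 := hp _ x.rep_nonzero hx
  have h2 := hp _ y.rep_nonzero hy
  rw [show i x.rep = i y.rep from hxy, ← h2] at h1
  rw [← x.mk_rep, ← y.mk_rep, Projectivization.mk_eq_mk_iff']
  refine ⟨(c x.rep)⁻¹ * c y.rep, ?_⟩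
  rw [mul_smul, ← h1, inv_smul_smul₀ (hc _ x.rep_nonzero hx)]

omit [Fintype F] in
lemma npts_le_one (P : Fin 4 → F) (h : ∀ v, v ≠ 0 → D v → ∃ c : F, v = c • P) :
    npts D ≤ 1 := by
  refine (npts_le_card {()} (fun _ => P) fun v hv hD => ?_).trans_eq (card_singleton _)
  obtain ⟨c, rfl⟩ := h v hv hD
  have hc : c ≠ 0 := by rintro rfl; simp at hv
  exact ⟨(), by simp, c⁻¹, inv_ne_zero hc, inv_smul_smul₀ hc P⟩

omit [Fintype F] in
lemma npts_eq_zero (h : ∀ v, v ≠ 0 → ¬ D v) : npts D = 0 :=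
  Nat.le_zero.1 ((npts_le_card (∅ : Finset Unit) (fun _ => 0)
    fun v hv hD => (h v hv hD).elim).trans_eq card_empty)

omit [Fintype F] in
open Classical in
lemma npts_le_sum {ι κ : Type} [Fintype ι] [Fintype κ] (p : ι → κ → Fin 4 → F)
    (E : ι → κ → Prop)
    (h : ∀ v, v ≠ 0 → D v → ∃ i k, E i k ∧ ∃ c : F, c ≠ 0 ∧ c • v = p i k) :
    npts D ≤ ∑ i, (univ.filter (E i)).card := by
  rw [← card_sigma]
  refine npts_le_card _ (fun x => p x.1 x.2) fun v hv hD => ?_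
  obtain ⟨i, k, hE, hc⟩ := h v hv hD
  exact ⟨⟨i, k⟩, by simpa using hE, hc⟩

lemma card_vectors_eq [DecidablePred D] (h0 : D 0) (h : ∀ (c : F) v, D v → D (c • v)) :
    (univ.filter D).card = 1 + (Fintype.card F - 1) * npts D := by
  classical
  have h1 : (univ.filter D) = insert 0 (univ.filter fun v => v ≠ 0 ∧ D v) := by
    ext v
    simp only [mem_filter, mem_univ, true_and, mem_insert]
    by_cases hv : v = 0 <;> simp [hv, h0]
  rw [h1, card_insert_of_notMem (by simp), add_comm, ← Fintype.card_units,
    ← Nat.card_eq_fintype_card, npts, ← Nat.card_coe_set_eq, ← Nat.card_prod,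
    ← Fintype.card_subtype, ← Nat.card_eq_fintype_card]
  congr 1
  refine (Nat.card_congr (Equiv.ofBijective (fun p => ⟨(p.1 : F) • p.2.1.rep,
    smul_ne_zero p.1.ne_zero p.2.1.rep_nonzero, h _ _ p.2.2⟩) ⟨?_, ?_⟩)).symm
  · rintro ⟨a, x, hx⟩ ⟨b, y, hy⟩ hxy
    simp only [Subtype.mk.injEq] at hxy
    have hxy' : x = y := by
      rw [← x.mk_rep, ← y.mk_rep, Projectivization.mk_eq_mk_iff']
      exact ⟨(a : F)⁻¹ * b, by rw [mul_smul, ← hxy, inv_smul_smul₀ a.ne_zero]⟩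
    subst hxy'
    have hab := smul_left_injective F x.rep_nonzero hxy
    simp only [Prod.mk.injEq, and_true]
    exact Units.ext hab
  · rintro ⟨v, hv, hD⟩
    obtain ⟨a, ha⟩ := Projectivization.exists_smul_eq_mk_rep F v hv
    refine ⟨⟨a⁻¹, Projectivization.mk F v hv, ?_⟩, ?_⟩
    · rw [Set.mem_ofPred_eq, ← ha]
      exact h _ _ hD
    · simp only [Subtype.mk.injEq, ← ha]
      exact inv_smul_smul a v

end ProjectivePoints

section Counting

lemma sum_le_of_exceptions {ι : Type} [Fintype ι] (r : ι → ℕ) (bad : ι → Prop) [DecidablePred bad]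
    {k m d : ℕ} (hbad : (univ.filter bad).card ≤ k) (h1 : ∀ i, bad i → r i ≤ m + d)
    (h2 : ∀ i, ¬ bad i → r i ≤ m) : ∑ i, r i ≤ Fintype.card ι * m + k * d := by
  calc ∑ i, r i ≤ ∑ i, (m + if bad i then d else 0) := by
        refine sum_le_sum fun i _ => ?_
        split_ifs with h
        · exact h1 i h
        · simpa using h2 i h
    _ = Fintype.card ι * m + (univ.filter bad).card * d := by
        rw [sum_add_distrib, ← sum_filter]; simp
    _ ≤ _ := by gcongr

lemma sum_le_card_mul {ι : Type} [Fintype ι] (r : ι → ℕ) {m : ℕ} (h : ∀ i, r i ≤ m) :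
    ∑ i, r i ≤ Fintype.card ι * m := by
  simpa using sum_le_card_nsmul univ r m fun i _ => h i

open Polynomial

variable {F : Type} [Field F] [Fintype F]

open Classical in
lemma card_roots_le (p : F[X]) (hp : p ≠ 0) {n : ℕ} (hn : p.natDegree ≤ n) :
    (univ.filter fun c => p.eval c = 0).card ≤ n := by
  refine le_trans ?_ ((card_roots' p).trans hn)
  refine (card_le_card fun c hc => ?_).trans (Multiset.toFinset_card_le p.roots)
  rw [Multiset.mem_toFinset, mem_roots hp]
  exact (mem_filter.1 hc).2

/-- Homogeneous coordinates on the projective line. -/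
def fstCoord : Option F → F
  | none => 0
  | some _ => 1

/-- Homogeneous coordinates on the projective line. -/
def sndCoord : Option F → F
  | none => 1
  | some c => c

open Classical in
lemma card_affine_le {t : ℕ} (ht : 2 ≤ t) {a b c d : F}
    (h : a ≠ 0 ∨ b ≠ 0 ∨ c ≠ 0 ∨ d ≠ 0) :
    (univ.filter fun x : F => a + b * x ^ t + c * x + d * x ^ (t + 1) = 0).card ≤
      if d = 0 then t else t + 1 := by
  have key := card_roots_le (C a + C b * X ^ t + C c * X + C d * X ^ (t + 1))
    (n := if d = 0 then t else t + 1)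
    (fun h0 => by
      have e0 := congrArg (coeff · 0) h0
      have e1 := congrArg (coeff · 1) h0
      have e2 := congrArg (coeff · t) h0
      have e3 := congrArg (coeff · (t + 1)) h0
      have n1 : (0 : ℕ) ≠ t := by omega
      have n2 : (1 : ℕ) ≠ t := by omega
      simp [coeff_X, coeff_C, coeff_X_pow, n1, n2, n1.symm] at e0 e1 e2 e3
      simp_all) (by
      split_ifs with hd
      · simp only [hd, C_0, zero_mul, add_zero]
        have : 1 ≤ t := by omega
        compute_degree!
      · have : 1 ≤ t + 1 := by omega
        compute_degree!)
  simpa using key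

open Classical in
lemma card_projective_le {t : ℕ} (ht : 2 ≤ t) {a b c d : F}
    (h : a ≠ 0 ∨ b ≠ 0 ∨ c ≠ 0 ∨ d ≠ 0) :
    (univ.filter fun x : Option F => a * (fstCoord x * fstCoord x ^ t) +
      b * (fstCoord x * sndCoord x ^ t) + c * (sndCoord x * fstCoord x ^ t) +
      d * (sndCoord x * sndCoord x ^ t) = 0).card ≤ t + 1 := by
  have h1 := card_affine_le ht h
  have ht0 : t ≠ 0 := by omega
  rw [card_filter, Fintype.sum_option]
  rw [card_filter] at h1
  simp only [fstCoord, sndCoord, one_pow, mul_one, one_mul, zero_pow ht0, mul_zero, zero_add,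
    ← pow_succ']
  split_ifs at h1 ⊢ <;> omega

open Classical in
/-- A Hermitian-type polynomial of degree `2t+2` without leading term. -/
lemma card_conic_le {t : ℕ} (ht : 2 ≤ t) (hF : Fintype.card F = t ^ 2)
    {h₀₀ h₀₁ h₀₂ h₁₀ h₁₁ h₁₂ h₂₀ h₂₁ : F}
    (h : h₀₀ ≠ 0 ∨ h₀₁ ≠ 0 ∨ h₀₂ ≠ 0 ∨ h₁₀ ≠ 0 ∨ h₁₁ ≠ 0 ∨ h₁₂ ≠ 0 ∨ h₂₀ ≠ 0 ∨ h₂₁ ≠ 0) :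
    (univ.filter fun x : F => h₀₀ + h₀₁ * x ^ t + h₀₂ * x ^ (2 * t) + h₁₀ * x +
      h₁₁ * x ^ (t + 1) + h₁₂ * x ^ (2 * t + 1) + h₂₀ * x ^ 2 + h₂₁ * x ^ (t + 2) = 0).card ≤
      2 * t + 1 := by
  obtain rfl | ht3 := ht.eq_or_lt
  · refine (card_le_univ _).trans ?_
    rw [hF]; norm_num
  have key := card_roots_le (C h₀₀ + C h₀₁ * X ^ t + C h₀₂ * X ^ (2 * t) + C h₁₀ * X +
      C h₁₁ * X ^ (t + 1) + C h₁₂ * X ^ (2 * t + 1) + C h₂₀ * X ^ 2 + C h₂₁ * X ^ (t + 2))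
      (n := 2 * t + 1)
    (fun h0 => by
      have e : ∀ n, coeff (C h₀₀ + C h₀₁ * X ^ t + C h₀₂ * X ^ (2 * t) + C h₁₀ * X +
        C h₁₁ * X ^ (t + 1) + C h₁₂ * X ^ (2 * t + 1) + C h₂₀ * X ^ 2 + C h₂₁ * X ^ (t + 2)) n
        = 0 := by simp [h0]
      simp only [coeff_add, coeff_C_mul, coeff_X_pow, coeff_X, coeff_C] at e
      have e0 := e 0
      have e1 := e 1
      have e2 := e 2
      have e3 := e t
      have e4 := e (t + 1)
      have e5 := e (t + 2)
      have e6 := e (2 * t)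
      have e7 := e (2 * t + 1)
      clear e
      have hc : ∀ (p : Prop) [Decidable p] (x : F), ¬ p → (if p then x else 0) = 0 :=
        fun p _ x hp => if_neg hp
      simp (disch := omega) only [hc, mul_zero, add_zero, zero_add]
        at e0 e1 e2 e3 e4 e5 e6 e7
      simp_all) (by
        have : 1 ≤ 2 * t + 1 := by omega
        have : 2 ≤ 2 * t + 1 := by omega
        have : t ≤ 2 * t + 1 := by omega
        have : t < 2 * t := by omega
        have : t + 1 ≤ 2 * t + 1 := by omega
        have : t + 2 ≤ 2 * t + 1 := by omega
        compute_degree!)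
  simpa using key

end Counting

section PlaneSections

variable {F : Type} [Field F]

lemma exists_basis_ker_inf_ker_of_ne_zero (φ ψ : (Fin 4 → F) →ₗ[F] F) {u w : Fin 4 → F}
    (h1 : φ u ≠ 0) (h3 : φ w = 0) (h4 : ψ w ≠ 0) :
    ∃ A B : Fin 4 → F, φ A = 0 ∧ ψ A = 0 ∧ φ B = 0 ∧ ψ B = 0 ∧
      (∀ a b : F, a • A + b • B = 0 → a = 0 ∧ b = 0) ∧
      ∀ v, φ v = 0 → ψ v = 0 → ∃ a b : F, v = a • A + b • B := by
  refine exists_basis_ker_inf_ker φ ψ (u := (φ u)⁻¹ • (u + (-(ψ u / ψ w)) • w))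
    (w := (ψ w)⁻¹ • w) ?_ ?_ ?_ ?_
  · simp [h1, h3]
  · simp [h4]
  · simp [h3]
  · simp [h4]

variable {t : ℕ} [Fintype F] [hF : IsHermitianField t F]

include hF

lemma herm_two (A B : Fin 4 → F) (a b : F) : herm t (a • A + b • B) (a • A + b • B) =
    herm t A A * (a * a ^ t) + herm t A B * (a * b ^ t) + herm t B A * (b * a ^ t) +
      herm t B B * (b * b ^ t) := by
  simp only [herm_add_left, herm_smul_left, herm_add_right, herm_smul_right]
  ring

lemma npts_line_le {D : (Fin 4 → F) → Prop} {A B : Fin 4 → F}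
    (hD : ∀ v, D v → ∃ a b : F, v = a • A + b • B) (hiso : ∀ v, D v → herm t v v = 0)
    (h : herm t A A ≠ 0 ∨ herm t A B ≠ 0 ∨ herm t B A ≠ 0 ∨ herm t B B ≠ 0) :
    npts D ≤ t + 1 := by
  classical
  refine le_trans ?_ (card_projective_le hF.two_le h)
  refine npts_le_card _ (fun i => fstCoord i • A + sndCoord i • B) fun v hv hDv => ?_
  obtain ⟨a, b, rfl⟩ := hD v hDv
  have hi := hiso _ hDv
  rw [herm_two] at hi
  by_cases ha : a = 0
  · subst ha
    have hb : b ≠ 0 := by rintro rfl; simp at hv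
    refine ⟨none, ?_, b⁻¹, inv_ne_zero hb, ?_⟩
    · refine mem_filter.2 ⟨mem_univ _, ?_⟩
      simpa [fstCoord, sndCoord, zero_pow_t, hb] using hi
    · simp [fstCoord, sndCoord, hb]
  · refine ⟨some (b / a), ?_, a⁻¹, inv_ne_zero ha, ?_⟩
    · refine mem_filter.2 ⟨mem_univ _, ?_⟩
      simp only [fstCoord, sndCoord, one_pow, mul_one, one_mul, div_pow]
      field_simp
      linear_combination hi
    · simp [fstCoord, sndCoord, smul_smul, ha, div_eq_inv_mul]

lemma npts_tangent_eq {R S : Fin 4 → F} (hR : herm t R R = 0) (hRS : herm t R S ≠ 0) :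
    npts (fun v => herm t v R = 0 ∧ herm t v v = 0) =
      1 + t ^ 2 * npts (fun v => herm t v R = 0 ∧ herm t v S = 0 ∧ herm t v v = 0) := by
  classical
  have hinv : ∀ (c : F) (v : Fin 4 → F), herm t v v = 0 → herm t (c • v) (c • v) = 0 :=
    fun c v h => by
    simp [herm_smul_left, herm_smul_right, h]
  have e1 := card_vectors_eq (D := fun v => herm t v R = 0 ∧ herm t v v = 0)
    (by simp [herm_zero_left]) (fun c v h => ⟨by simp [herm_smul_left, h.1], hinv c v h.2⟩)
  have e2 := card_vectors_eq (D := fun v => herm t v R = 0 ∧ herm t v S = 0 ∧ herm t v v = 0)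
    (by simp [herm_zero_left]) (fun c v h => ⟨by simp [herm_smul_left, h.1],
      by simp [herm_smul_left, h.2.1], hinv c v h.2.2⟩)
  have e3 : (univ.filter fun v => herm t v R = 0 ∧ herm t v v = 0).card =
      ((univ : Finset F) ×ˢ
        univ.filter fun v => herm t v R = 0 ∧ herm t v S = 0 ∧ herm t v v = 0).card := by
    have hself : ∀ (a : F) (v : Fin 4 → F), herm t v R = 0 →
        herm t (a • R + v) (a • R + v) = herm t v v := fun a v hv => by
      simp [herm_add_left, herm_smul_left, herm_add_right, herm_smul_right, hv, hR,
        herm_eq_zero_comm.1 hv]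
    refine card_nbij' (fun v => (herm t v S / herm t R S, (-(herm t v S / herm t R S)) • R + v))
      (fun p => p.1 • R + p.2) ?_ ?_ ?_ ?_
    · intro v hv
      simp only [coe_filter, mem_univ, true_and, Set.mem_ofPred_eq] at hv
      simp only [coe_product, coe_univ, coe_filter, mem_univ, true_and, Set.mem_prod, Set.mem_univ,
        Set.mem_ofPred_eq]
      refine ⟨by simp [herm_add_left, herm_smul_left, hR, hv.1], ?_, by rw [hself _ _ hv.1, hv.2]⟩
      rw [herm_add_left, herm_smul_left]
      field_simp
      ring
    · rintro ⟨a, v⟩ hv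
      simp only [coe_product, coe_univ, coe_filter, mem_univ, true_and, Set.mem_prod, Set.mem_univ,
        Set.mem_ofPred_eq] at hv
      simp only [coe_filter, mem_univ, true_and, Set.mem_ofPred_eq]
      exact ⟨by simp [herm_add_left, herm_smul_left, hR, hv.1], by rw [hself _ _ hv.1, hv.2.2]⟩
    · intro v hv
      simp
    · rintro ⟨a, v⟩ hv
      simp only [coe_product, coe_univ, coe_filter, mem_univ, true_and, Set.mem_prod, Set.mem_univ,
        Set.mem_ofPred_eq] at hv
      simp [herm_add_left, herm_smul_left, hv.2.1, hRS]
  rw [card_product, e1, e2, card_univ, hF.card_eq] at e3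
  have h4 : 4 ≤ t ^ 2 := by nlinarith [hF.two_le]
  obtain ⟨r, hr⟩ : ∃ r, t ^ 2 = r + 1 := ⟨t ^ 2 - 1, by omega⟩
  rw [hr] at e3 ⊢
  simp only [Nat.add_sub_cancel] at e3
  refine Nat.eq_of_mul_eq_mul_left (show 0 < r by omega) ?_
  linarith

lemma exists_herm_ne_zero {R : Fin 4 → F} (hR : R ≠ 0) : ∃ S, herm t S R ≠ 0 := by
  by_contra! h
  exact hR (eq_zero_of_herm h)

lemma npts_secant_le {R S : Fin 4 → F} (hR : herm t R R = 0) (hRS : herm t R S ≠ 0) :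
    npts (fun v => herm t v R = 0 ∧ herm t v S = 0 ∧ herm t v v = 0) ≤ t + 1 := by
  have hR0 : R ≠ 0 := by rintro rfl; simp [herm_zero_left] at hRS
  obtain ⟨u, hu⟩ := exists_herm_ne_zero (t := t) hR0
  obtain ⟨A, B, hA, hA', hB, hB', hind, hspan⟩ :=
    exists_basis_ker_inf_ker_of_ne_zero (hermLeft t R) (hermLeft t S) hu hR hRS
  refine npts_line_le (A := A) (B := B) (fun v hv => hspan v hv.1 hv.2.1) (fun v hv => hv.2.2) ?_
  by_contra! hz
  obtain ⟨h1, h2, h3, h4⟩ := hz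
  change herm t A R = 0 at hA
  change herm t A S = 0 at hA'
  obtain ⟨a, b, hab, h0⟩ := exists_dependent (t := t) (A := A) (B := R) (D := u) fun v => by
    refine ⟨herm t v R / herm t u R, v + (-(herm t v R / herm t u R)) • u, by simp, ?_, ?_⟩
    · set w := v + (-(herm t v R / herm t u R)) • u with hw
      have hwR : herm t w R = 0 := by
        rw [hw, herm_add_left, herm_smul_left]; field_simp; ring
      obtain ⟨x, y, hxy⟩ := hspan (w + (-(herm t w S / herm t R S)) • R)
        (by change herm t _ _ = 0; simp [herm_add_left, herm_smul_left, hwR, hR])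
        (by change herm t _ _ = 0; rw [herm_add_left, herm_smul_left]; field_simp; ring)
      obtain ⟨c, hw2⟩ : ∃ c : F, w = x • A + y • B + c • R :=
        ⟨herm t w S / herm t R S, by rw [← hxy]; simp⟩
      simp [hw2, h1, h3, herm_eq_zero_comm.1 hA]
    · rw [herm_add_left, herm_smul_left]; field_simp; ring
  have hb : b = 0 := by
    have := congrArg (herm t · S) h0
    simpa [herm_add_left, herm_smul_left, hA', hRS, herm_zero_left] using this
  subst hb
  exact hab.elim (· (hind a 0 (by simpa using h0)).1) (· rfl)

lemma npts_nontangent_le {R : Fin 4 → F} (hR : herm t R R ≠ 0) :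
    npts (fun v => herm t v R = 0 ∧ herm t v v = 0) ≤ t ^ 3 + 1 := by
  classical
  by_cases hP : ∃ P, P ≠ 0 ∧ herm t P R = 0 ∧ herm t P P = 0
  swap
  · rw [npts_eq_zero fun v hv h => hP ⟨v, hv, h⟩]
    exact Nat.zero_le _
  obtain ⟨P, hP0, hPR, hPP⟩ := hP
  have hRP := herm_eq_zero_comm.1 hPR
  obtain ⟨A, hAR, hAP⟩ : ∃ A, herm t A R = 0 ∧ herm t A P ≠ 0 := by
    by_contra! h
    refine hP0 (eq_zero_of_herm (t := t) fun v => ?_)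
    have := h (v + (-(herm t v R / herm t R R)) • R)
      (by rw [herm_add_left, herm_smul_left]; field_simp; ring)
    simpa [herm_add_left, herm_smul_left, hRP] using this
  obtain ⟨B, hBR, hBP, hind, hspan⟩ : ∃ B, herm t B R = 0 ∧ herm t B P = 0 ∧
      (∀ x z : F, x • P + z • B = 0 → x = 0 ∧ z = 0) ∧
      ∀ v, herm t v R = 0 → herm t v P = 0 → ∃ x z : F, v = x • P + z • B := by
    obtain ⟨A', B', hA1, hA2, hB1, hB2, hind, hspan⟩ :=
      exists_basis_ker_inf_ker_of_ne_zero (hermLeft t R) (hermLeft t P) hR hAR hAP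
    obtain ⟨a, b, rfl⟩ := hspan P hPR hPP
    by_cases ha : a = 0
    · subst ha
      have hb : b ≠ 0 := by rintro rfl; simp at hP0
      refine ⟨A', hA1, hA2, fun x z h => ?_, fun v h1 h2 => ?_⟩
      · have := hind z (x * b) (by rw [← h]; module)
        exact ⟨(mul_eq_zero.1 this.2).resolve_right hb, this.1⟩
      · obtain ⟨x, y, rfl⟩ := hspan v h1 h2
        refine ⟨y / b, x, ?_⟩
        match_scalars <;> field_simp <;> ring
    · refine ⟨B', hB1, hB2, fun x z h => ?_, fun v h1 h2 => ?_⟩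
      · have := hind (x * a) (x * b + z) (by rw [← h]; module)
        have hx := (mul_eq_zero.1 this.1).resolve_right ha
        exact ⟨hx, by simpa [hx] using this.2⟩
      · obtain ⟨x, y, rfl⟩ := hspan v h1 h2
        refine ⟨x / a, y - x / a * b, ?_⟩
        match_scalars <;> field_simp
        ring
  have hPB := herm_eq_zero_comm.1 hBP
  have hRB := herm_eq_zero_comm.1 hBR
  have hBB : herm t B B ≠ 0 := by
    intro hBB
    obtain ⟨a, b, hab, h0⟩ := exists_dependent (t := t) (A := P) (B := B) (D := A) fun v => by
      have hw1 : herm t (v + (-(herm t v P / herm t A P)) • A) P = 0 := by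
        rw [herm_add_left, herm_smul_left]; field_simp; ring
      refine ⟨herm t v P / herm t A P, v + (-(herm t v P / herm t A P)) • A, by simp, hw1, ?_⟩
      set w := v + (-(herm t v P / herm t A P)) • A
      obtain ⟨x, z, hxz⟩ := hspan (w + (-(herm t w R / herm t R R)) • R)
        (by rw [herm_add_left, herm_smul_left]; field_simp; ring)
        (by simp [herm_add_left, herm_smul_left, hw1, hRP])
      obtain ⟨c, hw2⟩ : ∃ c : F, w = x • P + z • B + c • R :=
        ⟨herm t w R / herm t R R, by rw [← hxz]; simp⟩
      simp [hw2, hPB, hRB, hBB]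
    have := hind a b h0
    exact hab.elim (· this.1) (· this.2)
  have hspan' : ∀ v, herm t v R = 0 →
      ∃ x z : F, v = x • P + z • B + (herm t v P / herm t A P) • A := fun v hv => by
    obtain ⟨x, z, h⟩ := hspan (v + (-(herm t v P / herm t A P)) • A)
      (by simp [herm_add_left, herm_smul_left, hv, hAR])
      (by rw [herm_add_left, herm_smul_left]; field_simp; ring)
    exact ⟨x, z, by rw [← h]; simp⟩
  have hone : npts (fun v => ∃ c : F, v = c • P) ≤ 1 := npts_le_one P fun v _ h => h
  have hrest : npts (fun v => herm t v P ≠ 0 ∧ herm t v R = 0 ∧ herm t v v = 0) ≤ t ^ 2 * t := by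
    refine (npts_le_sum (fun z x : F => x • P + (A + z • B))
      (fun z x => herm t (x • P + (A + z • B)) (x • P + (A + z • B)) = 0) ?_).trans ?_
    · rintro v - ⟨h1, h2, h3⟩
      obtain ⟨x, z, hv⟩ := hspan' v h2
      have hy : herm t v P / herm t A P ≠ 0 := div_ne_zero h1 hAP
      generalize herm t v P / herm t A P = y at hv hy
      have key : y⁻¹ • v = (x / y) • P + (A + (z / y) • B) := by
        rw [hv]; match_scalars <;> field_simp
      refine ⟨z / y, x / y, ?_, y⁻¹, inv_ne_zero hy, key⟩
      rw [← key]
      simp [herm_smul_left, herm_smul_right, h3]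
    · refine (sum_le_card_mul _ fun z => ?_).trans_eq (by rw [hF.card_eq])
      have hK : herm t (A + z • B) P ≠ 0 := by
        simpa [herm_add_left, herm_smul_left, hBP] using hAP
      have := card_affine_le hF.two_le (a := herm t (A + z • B) (A + z • B))
        (b := herm t (A + z • B) P) (c := herm t P (A + z • B)) (d := 0) (.inr (.inl hK))
      rw [if_pos rfl] at this
      convert this using 4 with x
      simp only [herm_add_left (x • P), herm_add_right _ (x • P), herm_smul_left x,
        herm_smul_right x, hPP]
      ring
  have := npts_le_add (D := fun v => herm t v R = 0 ∧ herm t v v = 0)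
    (D₁ := fun v => ∃ c : F, v = c • P)
    (D₂ := fun v => herm t v P ≠ 0 ∧ herm t v R = 0 ∧ herm t v v = 0) fun v hv hD => by
      by_cases h : herm t v P = 0
      · left
        obtain ⟨x, z, hxz⟩ := hspan v hD.1 h
        have hz := hD.2
        rw [hxz, herm_two] at hz
        have : z = 0 := by
          simpa [hPP, hPB, hBP, hBB, (pos_of_isHermitianField (t := t) (F := F)).ne'] using hz
        exact ⟨x, by rw [hxz, this]; simp⟩
      · exact Or.inr ⟨h, hD⟩
  calc _ ≤ 1 + t ^ 2 * t := by omega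
    _ = _ := by ring

lemma npts_plane_le {R : Fin 4 → F} (hR : R ≠ 0) :
    npts (fun v => herm t v R = 0 ∧ herm t v v = 0) ≤ t ^ 3 + t ^ 2 + 1 := by
  by_cases h : herm t R R = 0
  · obtain ⟨S, hS⟩ := exists_herm_ne_zero (t := t) hR
    have hRS : herm t R S ≠ 0 := fun h => hS (herm_eq_zero_comm.1 h)
    rw [npts_tangent_eq h hRS]
    nlinarith [npts_secant_le h hRS, Nat.mul_le_mul_left (t ^ 2) (npts_secant_le h hRS)]
  · exact (npts_nontangent_le h).trans (by nlinarith)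

/-- The possible sizes of the intersection of a quadric with the Hermitian surface. -/
def IsQuadricSectionSize (t N : ℕ) : Prop :=
  N = 2 * (t ^ 3 + t ^ 2 - t) + t + 1 ∨ N ≤ 2 * t ^ 3 + t ^ 2 + 1

lemma npts_two_planes {R S u w : Fin 4 → F} (hu : herm t u R ≠ 0) (huS : herm t u S = 0)
    (hw : herm t w S ≠ 0) (hwR : herm t w R = 0) :
    IsQuadricSectionSize t
      (npts fun v => (herm t v R = 0 ∨ herm t v S = 0) ∧ herm t v v = 0) := by
  classical
  wlog hRR : herm t R R = 0 ∨ (herm t R R ≠ 0 ∧ herm t S S ≠ 0) generalizing R S u w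
  · have := this hw hwR hu huS (by tauto)
    simpa only [or_comm] using this
  have ht2 := hF.two_le
  have hR0 : R ≠ 0 := by rintro rfl; simp [herm_zero_right] at hu
  have hS0 : S ≠ 0 := by rintro rfl; simp [herm_zero_right] at hw
  have hcard := npts_or_add_npts_and (F := F) (fun v => herm t v R = 0 ∧ herm t v v = 0)
    (fun v => herm t v S = 0 ∧ herm t v v = 0)
  have e1 : (fun v : Fin 4 → F => herm t v R = 0 ∧ herm t v v = 0 ∨
      herm t v S = 0 ∧ herm t v v = 0) =
      fun v => (herm t v R = 0 ∨ herm t v S = 0) ∧ herm t v v = 0 := by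
    ext v; tauto
  have e2 : (fun v : Fin 4 → F => (herm t v R = 0 ∧ herm t v v = 0) ∧
      herm t v S = 0 ∧ herm t v v = 0) =
      fun v => herm t v R = 0 ∧ herm t v S = 0 ∧ herm t v v = 0 := by
    ext v; tauto
  have e3 : (fun v : Fin 4 → F => herm t v S = 0 ∧ herm t v R = 0 ∧ herm t v v = 0) =
      fun v => herm t v R = 0 ∧ herm t v S = 0 ∧ herm t v v = 0 := by
    ext v; tauto
  rw [e1, e2] at hcard
  have hbR := npts_plane_le (t := t) hR0
  have hbS := npts_plane_le (t := t) hS0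
  obtain hRR | ⟨hRR, hSS⟩ := hRR
  swap
  · right
    have h1 := npts_nontangent_le hRR
    have h2 := npts_nontangent_le hSS
    have : 1 ≤ t ^ 2 := Nat.one_le_pow _ _ (by omega)
    omega
  by_cases hRS : herm t R S = 0
  · by_cases hSS : herm t S S = 0
    · right
      have hl : t ^ 2 + 1 ≤ npts fun v : Fin 4 → F =>
          herm t v R = 0 ∧ herm t v S = 0 ∧ herm t v v = 0 := by
        have hc := card_vectors_eq
          (D := fun v : Fin 4 → F => herm t v R = 0 ∧ herm t v S = 0 ∧ herm t v v = 0)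
          (by simp [herm_zero_left]) (fun c v h => by
            simp [herm_smul_left, herm_smul_right, h.1, h.2.1, h.2.2])
        have hq : (univ : Finset (F × F)).card ≤ (univ.filter fun v : Fin 4 → F =>
            herm t v R = 0 ∧ herm t v S = 0 ∧ herm t v v = 0).card := by
          have hSR := herm_eq_zero_comm.1 hRS
          refine card_le_card_of_injOn (fun p => p.1 • R + p.2 • S) ?_ ?_
          · intro p _
            rw [mem_coe, mem_filter]
            simp [hRR, hSS, hRS, hSR]
          · rintro ⟨a, b⟩ - ⟨a', b'⟩ - h
            have h1 := congrArg (herm t u) h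
            have h2 := congrArg (herm t w) h
            simp only [herm_add_right, herm_smul_right, huS, hwR, mul_zero, add_zero, zero_add,
              mul_eq_mul_right_iff, hu, hw, or_false] at h1 h2
            have h1' := congrArg (· ^ t) h1
            have h2' := congrArg (· ^ t) h2
            simp only [pow_pow_t] at h1' h2'
            rw [h1', h2']
        rw [hc, card_univ, Fintype.card_prod, hF.card_eq] at hq
        have h4 : 4 ≤ t ^ 2 := by nlinarith
        obtain ⟨r, hr⟩ : ∃ r, t ^ 2 = r + 1 := ⟨t ^ 2 - 1, by omega⟩
        rw [hr] at hq ⊢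
        simp only [Nat.add_sub_cancel] at hq
        refine Nat.le_of_mul_le_mul_left (c := r) ?_ (by omega)
        linarith
      omega
    · right
      have h2 := npts_nontangent_le hSS
      have hl : 1 ≤ npts fun v : Fin 4 → F =>
          herm t v R = 0 ∧ herm t v S = 0 ∧ herm t v v = 0 := by
        have hc := card_vectors_eq
          (D := fun v : Fin 4 → F => herm t v R = 0 ∧ herm t v S = 0 ∧ herm t v v = 0)
          (by simp [herm_zero_left]) (fun c v h => by
            simp [herm_smul_left, herm_smul_right, h.1, h.2.1, h.2.2])
        by_contra! h0
        rw [Nat.lt_one_iff.1 h0, mul_zero, add_zero, card_eq_one] at hc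
        obtain ⟨a, ha⟩ := hc
        have m1 : (0 : Fin 4 → F) ∈ ({a} : Finset (Fin 4 → F)) := by
          rw [← ha]; simp [herm_zero_left]
        have m2 : R ∈ ({a} : Finset (Fin 4 → F)) := by
          rw [← ha]; simp [hRR, hRS]
        rw [mem_singleton] at m1 m2
        exact hR0 (m2.trans m1.symm)
      omega
  · have hR := npts_tangent_eq hRR hRS
    by_cases hSS : herm t S S = 0
    · have hSR : herm t S R ≠ 0 := fun h => hRS (herm_eq_zero_comm.1 h)
      have hS := npts_tangent_eq hSS hSR
      have hle := npts_secant_le hRR hRS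
      rw [e3] at hS
      rw [hR, hS] at hcard
      generalize npts (fun v : Fin 4 → F => herm t v R = 0 ∧ herm t v S = 0 ∧ herm t v v = 0) = c
        at *
      obtain rfl | hlt := hle.eq_or_lt
      · left
        have : t ≤ t ^ 3 + t ^ 2 := by nlinarith [Nat.one_le_pow 2 t (by omega)]
        have e : t ^ 2 * (t + 1) = t ^ 3 + t ^ 2 := by ring
        rw [e] at hcard
        omega
      · right
        have : t ^ 2 * c ≤ t ^ 2 * t := Nat.mul_le_mul_left _ (by omega)
        have e : t ^ 2 * t = t ^ 3 := by ring
        have : 1 ≤ t ^ 2 := Nat.one_le_pow _ _ (by omega)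
        omega
    · right
      have h2 := npts_nontangent_le hSS
      by_cases hc : npts (fun v : Fin 4 → F => herm t v R = 0 ∧ herm t v S = 0 ∧ herm t v v = 0) = 0
      · rw [hc] at hR
        have : 1 ≤ t ^ 3 := Nat.one_le_pow _ _ (by omega)
        omega
      · omega

end PlaneSections

section Quadrics

variable {F : Type} [Field F]

lemma npts_span_two_le [Fintype F] (A B : Fin 4 → F) :
    npts (fun v => ∃ a b : F, v = a • A + b • B) ≤ Fintype.card F + 1 := by
  rw [← Fintype.card_option, ← card_univ]
  refine npts_le_card _ (fun i => fstCoord i • A + sndCoord i • B) ?_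
  rintro v hv ⟨a, b, rfl⟩
  by_cases ha : a = 0
  · subst ha
    have hb : b ≠ 0 := by rintro rfl; simp at hv
    exact ⟨none, mem_univ _, b⁻¹, inv_ne_zero hb, by simp [fstCoord, sndCoord, hb]⟩
  · exact ⟨some (b / a), mem_univ _, a⁻¹, inv_ne_zero ha,
      by simp [fstCoord, sndCoord, smul_smul, ha, div_eq_inv_mul]⟩

lemma npts_le_add_not [Fintype F] (D E : (Fin 4 → F) → Prop) :
    npts D ≤ npts E + npts (fun v => ¬ E v ∧ D v) :=
  npts_le_add fun v _ h => by tauto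

/-- A quadratic form at a nonsingular zero `P` splits off a hyperbolic plane containing `P`. -/
lemma exists_frame (C : (Fin 4 → F) →ₗ[F] (Fin 4 → F) →ₗ[F] F) {P y : Fin 4 → F} (hP : C P P = 0)
    (hy : C P y + C y P ≠ 0) :
    ∃ (e0 e1 e2 : Fin 4 → F) (α β γ : F), IsFrame e0 e1 e2 P ∧ ∀ a b c d : F,
      C (a • e0 + b • e1 + c • e2 + d • P) (a • e0 + b • e1 + c • e2 + d • P) =
        a * d + (α * b ^ 2 + β * (b * c) + γ * c ^ 2) := by
  obtain ⟨z, hz, hPz⟩ : ∃ z, C z z = 0 ∧ C P z + C z P = 1 := by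
    refine ⟨(C P y + C y P)⁻¹ • (y + (-(C y y / (C P y + C y P))) • P), ?_, ?_⟩
    · simp only [map_add, map_smul, LinearMap.add_apply, LinearMap.smul_apply, smul_eq_mul, hP]
      field_simp
      ring
    · simp only [map_add, map_smul, LinearMap.add_apply, LinearMap.smul_apply, smul_eq_mul, hP]
      field_simp
      ring
  have hφ : ∀ x v, (C x + C.flip x) v = C x v + C v x := fun x v => rfl
  obtain ⟨A, B, hA, hA', hB, hB', -, hspan⟩ :=
    exists_basis_ker_inf_ker (C P + C.flip P) (C z + C.flip z) (u := z) (w := P)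
      (by rw [hφ, hPz]) (by rw [hφ, hz, add_zero]) (by rw [hφ, hP, add_zero])
      (by rw [hφ, add_comm, hPz])
  rw [hφ] at hA hA' hB hB'
  refine ⟨z, A, B, C A A, C A B + C B A, C B B, fun v => ?_, fun a b c d => ?_⟩
  · obtain ⟨b, c, h⟩ := hspan
      (v + (-(C P v + C v P)) • z + (-(C z v + C v z)) • P) (by
        rw [hφ]
        simp only [map_add, map_smul, LinearMap.add_apply, LinearMap.smul_apply, smul_eq_mul, hP]
        linear_combination (-(C P v + C v P)) * hPz) (by
        rw [hφ]
        simp only [map_add, map_smul, LinearMap.add_apply, LinearMap.smul_apply, smul_eq_mul, hz]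
        linear_combination (-(C z v + C v z)) * hPz)
    refine ⟨C P v + C v P, b, c, C z v + C v z, ?_⟩
    generalize C P v + C v P = x at h ⊢
    generalize C z v + C v z = y at h ⊢
    calc v = (v + (-x) • z + (-y) • P) + x • z + y • P := by module
      _ = x • z + b • A + c • B + y • P := by rw [h]; module
  · simp only [map_add, map_smul, LinearMap.add_apply, LinearMap.smul_apply, smul_eq_mul, hz, hP]
    linear_combination a * d * hPz + b * d * hA + a * b * hA' + c * d * hB + a * c * hB'

variable {t : ℕ} [Fintype F] [hF : IsHermitianField t F] {g : (Fin 4 → F) → F}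
  {e0 e1 e2 e3 : Fin 4 → F}

include hF

lemma herm_conic (A B C : Fin 4 → F) (hC : herm t C C = 0) (x : F) :
    herm t (A + x • B + x ^ 2 • C) (A + x • B + x ^ 2 • C) =
      herm t A A + herm t A B * x ^ t + herm t A C * x ^ (2 * t) + herm t B A * x +
      herm t B B * x ^ (t + 1) + herm t B C * x ^ (2 * t + 1) + herm t C A * x ^ 2 +
      herm t C B * x ^ (t + 2) := by
  simp only [herm_add_left, herm_smul_left, herm_add_right, herm_smul_right, hC]
  ring

lemma npts_elliptic_le (hfr : IsFrame e0 e1 e2 e3) {α β γ : F} (hg : ∀ a b c d : F,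
      g (a • e0 + b • e1 + c • e2 + d • e3) = a * d + (α * b ^ 2 + β * (b * c) + γ * c ^ 2))
    (hN : ∀ b c : F, α * b ^ 2 + β * (b * c) + γ * c ^ 2 = 0 → b = 0 ∧ c = 0)
    (h3 : herm t e3 e3 = 0) :
    npts (fun v => g v = 0 ∧ herm t v v = 0) ≤ 2 * t ^ 3 + t ^ 2 + 1 := by
  classical
  have hγ : γ ≠ 0 := by
    rintro rfl
    exact one_ne_zero (hN 0 1 (by simp)).2
  have h1 : npts (fun v : Fin 4 → F => ∃ c : F, v = c • e3) ≤ 1 := npts_le_one e3 fun v _ h => h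
  have h2 : npts (fun v => (¬ ∃ c : F, v = c • e3) ∧ g v = 0 ∧ herm t v v = 0) ≤
      t ^ 2 * (2 * t + 1) := by
    let A : F → Fin 4 → F := fun b => e0 + b • e1 + (-(α * b ^ 2)) • e3
    let B : F → Fin 4 → F := fun b => e2 + (-(β * b)) • e3
    let C : Fin 4 → F := (-γ) • e3
    have hC : herm t C C = 0 := by
      simp only [C, herm_smul_left, herm_smul_right, h3, mul_zero]
    refine (npts_le_sum (fun b c : F => A b + c • B b + c ^ 2 • C)
      (fun b c => herm t (A b + c • B b + c ^ 2 • C) (A b + c • B b + c ^ 2 • C) = 0) ?_).trans ?_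
    · rintro v hv ⟨hv3, hgv, hhv⟩
      obtain ⟨a, b, c, d, rfl⟩ := hfr v
      rw [hg] at hgv
      have ha : a ≠ 0 := by
        rintro rfl
        obtain ⟨rfl, rfl⟩ := hN b c (by simpa using hgv)
        exact hv3 ⟨d, by simp⟩
      have key : a⁻¹ • (a • e0 + b • e1 + c • e2 + d • e3) =
          A (b / a) + (c / a) • B (b / a) + (c / a) ^ 2 • C := by
        simp only [A, B, C]
        match_scalars
        · field_simp
        · field_simp
        · field_simp
        · field_simp
          linear_combination hgv
      refine ⟨b / a, c / a, ?_, a⁻¹, inv_ne_zero ha, key⟩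
      rw [← key, herm_smul_left, herm_smul_right, hhv, mul_zero, mul_zero]
    · refine (sum_le_card_mul _ fun b => ?_).trans_eq (by rw [hF.card_eq])
      simp only [herm_conic _ _ _ hC]
      have hne : herm t (A b) (A b) ≠ 0 ∨ herm t (A b) (B b) ≠ 0 ∨ herm t (A b) C ≠ 0 ∨
          herm t (B b) (A b) ≠ 0 ∨ herm t (B b) (B b) ≠ 0 ∨ herm t (B b) C ≠ 0 ∨
          herm t C (A b) ≠ 0 ∨ herm t C (B b) ≠ 0 := by
        by_contra! hz
        obtain ⟨z1, z2, z3, z4, z5, z6, z7, z8⟩ := hz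
        obtain ⟨x, y, hxy, h0⟩ := exists_dependent (t := t) (A := B b) (B := C) (D := e1)
          fun v => by
            obtain ⟨x0, x1, x2, x3, rfl⟩ := hfr v
            refine ⟨x1 - x0 * b, x0 • A b + x2 • B b +
              (-(x3 + x0 * (α * b ^ 2) + x2 * (β * b)) / γ) • C, ?_, ?_, ?_⟩
            · simp only [A, B, C]
              match_scalars <;> field_simp <;> ring
            · simp only [herm_add_left, herm_smul_left, z2, z5, z8, mul_zero, add_zero]
            · simp only [herm_add_left, herm_smul_left, z3, z6, hC, mul_zero, add_zero]
        have hi := hfr.indep (a := 0) (b := 0) (c := x) (d := -(x * (β * b)) - y * γ) (by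
          rw [← h0]; simp only [B, C]; module)
        have hx := hi.2.2.1
        have hy : y = 0 := by
          have := hi.2.2.2
          rw [hx] at this
          simpa [hγ] using this
        exact hxy.elim (· hx) (· hy)
      convert card_conic_le hF.two_le hF.card_eq hne
  have := npts_le_add_not (fun v => g v = 0 ∧ herm t v v = 0) (fun v => ∃ c : F, v = c • e3)
  calc _ ≤ 1 + t ^ 2 * (2 * t + 1) := by omega
    _ = _ := by ring

lemma npts_cone_le (hfr : IsFrame e0 e1 e2 e3) {γ : F} (hγ : γ ≠ 0) (hg : ∀ a b c d : F,
      g (a • e0 + b • e1 + c • e2 + d • e3) = a * d + γ * c ^ 2) :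
    npts (fun v => g v = 0 ∧ herm t v v = 0) ≤ 2 * t ^ 3 + t ^ 2 + 1 := by
  classical
  have h1 := npts_span_two_le e1 e3
  have ht := hF.two_le
  have h2 : npts (fun v => (¬ ∃ a b : F, v = a • e1 + b • e3) ∧ g v = 0 ∧ herm t v v = 0) ≤
      t ^ 2 * (t + 1) + 2 * (t ^ 2 - (t + 1)) := by
    let K : F → Fin 4 → F := fun c => e0 + c • e2 + (-(γ * c ^ 2)) • e3
    have hK : ∀ a c, herm t (K c + a • e1) (K c + a • e1) = herm t (K c) (K c) +
        herm t (K c) e1 * a ^ t + herm t e1 (K c) * a + herm t e1 e1 * a ^ (t + 1) := fun a c => by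
      simp only [herm_add_left _ (a • e1), herm_smul_left a, herm_add_right _ _ (a • e1),
        herm_smul_right a]
      ring
    refine (npts_le_sum (fun c a : F => K c + a • e1)
      (fun c a => herm t (K c + a • e1) (K c + a • e1) = 0) ?_).trans ?_
    · rintro v hv ⟨hv3, hgv, hhv⟩
      obtain ⟨a, b, c, d, rfl⟩ := hfr v
      rw [hg] at hgv
      have ha : a ≠ 0 := by
        rintro rfl
        have hc : c = 0 := by simpa [hγ] using hgv
        exact hv3 ⟨b, d, by simp [hc]⟩
      have key : a⁻¹ • (a • e0 + b • e1 + c • e2 + d • e3) = K (c / a) + (b / a) • e1 := by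
        simp only [K]
        match_scalars
        · field_simp
        · field_simp
        · field_simp
        · field_simp
          linear_combination hgv
      refine ⟨c / a, b / a, ?_, a⁻¹, inv_ne_zero ha, key⟩
      rw [← key, herm_smul_left, herm_smul_right, hhv, mul_zero, mul_zero]
    · rw [← hF.card_eq (F := F)]
      refine sum_le_of_exceptions _ (fun c => herm t e1 e1 = 0 ∧ herm t (K c) e1 = 0) ?_ ?_ ?_
      · by_cases h11 : herm t e1 e1 = 0
        · have hKe : ∀ c, herm t (K c) e1 =
              herm t e0 e1 + herm t e2 e1 * c + -(γ * herm t e3 e1) * c ^ 2 := fun c => by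
            simp only [K, herm_add_left, herm_smul_left]
            ring
          simp only [h11, true_and, hKe]
          refine le_trans (le_of_eq ?_) (card_roots_le (Polynomial.C (herm t e0 e1) +
            Polynomial.C (herm t e2 e1) * Polynomial.X +
            Polynomial.C (-(γ * herm t e3 e1)) * Polynomial.X ^ 2) (fun h0 => ?_)
            (by compute_degree!))
          · congr! 2
            simp
          · have c0 := congrArg (Polynomial.coeff · 0) h0
            have c1 := congrArg (Polynomial.coeff · 1) h0
            have c2 := congrArg (Polynomial.coeff · 2) h0
            simp only [Polynomial.coeff_add, Polynomial.coeff_C_mul, Polynomial.coeff_X_pow,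
              Polynomial.coeff_X, Polynomial.coeff_C, Polynomial.coeff_zero] at c0 c1 c2
            simp [hγ] at c0 c1 c2
            have : e1 = 0 := eq_zero_of_herm (t := t) fun v => by
              obtain ⟨a, b, c, d, rfl⟩ := hfr v
              simp [c0, c1, c2, h11]
            have := (hfr.indep (a := 0) (b := 1) (c := 0) (d := 0) (by simp [this])).2.1
            exact one_ne_zero this
        · simp [h11]
      · intro c _
        refine (card_le_univ _).trans ?_
        rw [hF.card_eq]
        omega
      · intro c hc
        simp only [hK]
        have h := card_affine_le ht (a := herm t (K c) (K c)) (b := herm t (K c) e1)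
          (c := herm t e1 (K c)) (d := herm t e1 e1) (by tauto)
        have h' := h.trans (show _ ≤ t + 1 by split_ifs <;> omega)
        convert h'
  have := npts_le_add_not (fun v => g v = 0 ∧ herm t v v = 0)
    (fun v => ∃ a b : F, v = a • e1 + b • e3)
  have h4 : t + 1 ≤ t ^ 2 := by nlinarith
  obtain ⟨s, hs⟩ := Nat.exists_eq_add_of_le h4
  have hs' : t ^ 2 - (t + 1) = s := by omega
  rw [hs'] at h2
  rw [hF.card_eq] at h1
  have h5 : t ^ 2 * (t + 1) + 2 * s + (t ^ 2 + 1) ≤ 2 * t ^ 3 + t ^ 2 + 1 := by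
    obtain ⟨k, rfl⟩ := Nat.exists_eq_add_of_le ht
    nlinarith [Nat.zero_le (k ^ 3), Nat.zero_le (k ^ 2)]
  omega

lemma npts_hyperbolic_le (hfr : IsFrame e0 e1 e2 e3) (hg : ∀ a b c d : F,
      g (a • e0 + b • e1 + c • e2 + d • e3) = b * c - a * d) :
    npts (fun v => g v = 0 ∧ herm t v v = 0) ≤ 2 * t ^ 3 + t ^ 2 + 1 := by
  classical
  have ht := hF.two_le
  let R : Option F → Fin 4 → F := fun i => fstCoord i • e0 + sndCoord i • e1
  let S : Option F → Fin 4 → F := fun i => fstCoord i • e2 + sndCoord i • e3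
  have h2 : npts (fun v => g v = 0 ∧ herm t v v = 0) ≤
      (t ^ 2 + 1) * (t + 1) + (t + 1) * (t ^ 2 - t) := by
    refine (npts_le_sum (fun i k : Option F => fstCoord k • R i + sndCoord k • S i)
      (fun i k : Option F => herm t (fstCoord k • R i + sndCoord k • S i)
        (fstCoord k • R i + sndCoord k • S i) = 0) ?_).trans ?_
    · rintro v hv ⟨hgv, hhv⟩
      suffices ∃ i k, ∃ c : F, c ≠ 0 ∧ c • v = fstCoord k • R i + sndCoord k • S i by
        obtain ⟨i, k, c, hc, h⟩ := this
        refine ⟨i, k, ?_, c, hc, h⟩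
        rw [← h, herm_smul_left, herm_smul_right, hhv, mul_zero, mul_zero]
      obtain ⟨a, b, c, d, rfl⟩ := hfr v
      rw [hg] at hgv
      simp only [R, S]
      by_cases ha : a = 0
      · subst ha
        by_cases hb : b = 0
        · subst hb
          by_cases hc : c = 0
          · subst hc
            have hd : d ≠ 0 := by rintro rfl; simp at hv
            exact ⟨none, none, d⁻¹, inv_ne_zero hd, by simp [fstCoord, sndCoord, hd]⟩
          · exact ⟨some (d / c), none, c⁻¹, inv_ne_zero hc, by
              simp [fstCoord, sndCoord, hc, smul_smul, div_eq_inv_mul]⟩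
        · have hc : c = 0 := by simpa [hb] using hgv
          subst hc
          exact ⟨none, some (d / b), b⁻¹, inv_ne_zero hb, by
            simp [fstCoord, sndCoord, hb, smul_smul, div_eq_inv_mul]⟩
      · refine ⟨some (b / a), some (c / a), a⁻¹, inv_ne_zero ha, ?_⟩
        simp only [fstCoord, sndCoord]
        match_scalars
        · field_simp
        · field_simp
        · field_simp
        · field_simp
          linear_combination -hgv
    · have hcard : Fintype.card (Option F) = t ^ 2 + 1 := by rw [Fintype.card_option, hF.card_eq]
      rw [← hcard]
      refine sum_le_of_exceptions _ (fun i => herm t (R i) (R i) = 0 ∧ herm t (R i) (S i) = 0 ∧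
        herm t (S i) (R i) = 0 ∧ herm t (S i) (S i) = 0) ?_ ?_ ?_
      · have hSR : ∀ i, herm t (S i) (R i) =
            herm t e2 e0 * (fstCoord i * fstCoord i ^ t) +
            herm t e2 e1 * (fstCoord i * sndCoord i ^ t) +
            herm t e3 e0 * (sndCoord i * fstCoord i ^ t) +
            herm t e3 e1 * (sndCoord i * sndCoord i ^ t) := fun i => by
          simp only [R, S, herm_add_left, herm_smul_left, herm_add_right, herm_smul_right]
          ring
        by_cases h00 : herm t e0 e0 = 0 ∧ herm t e1 e0 = 0
        · have h : herm t e2 e0 ≠ 0 ∨ herm t e2 e1 ≠ 0 ∨ herm t e3 e0 ≠ 0 ∨ herm t e3 e1 ≠ 0 := by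
            by_contra! hz
            have : e0 = 0 := eq_zero_of_herm (t := t) fun v => by
              obtain ⟨a, b, c, d, rfl⟩ := hfr v
              simp [hz.1, hz.2.2.1, h00.1, h00.2]
            have := (hfr.indep (a := 1) (b := 0) (c := 0) (d := 0) (by simp [this])).1
            exact one_ne_zero this
          refine (card_le_card fun i hi => ?_).trans (card_projective_le ht h)
          rw [mem_filter, ← hSR]
          exact ⟨mem_univ _, (mem_filter.1 hi).2.2.2.1⟩
        · refine (card_le_card fun i hi => ?_).trans (card_projective_le ht (a := herm t e0 e0)
            (b := herm t e0 e1) (c := herm t e1 e0) (d := herm t e1 e1) (by tauto))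
          rw [mem_filter, ← herm_two]
          exact ⟨mem_univ _, (mem_filter.1 hi).2.1⟩
      · intro i _
        refine (card_le_univ _).trans ?_
        rw [hcard]
        have : t ≤ t ^ 2 := by nlinarith
        omega
      · intro i hi
        simp only [herm_two]
        convert card_projective_le ht (a := herm t (R i) (R i))
            (b := herm t (R i) (S i)) (c := herm t (S i) (R i)) (d := herm t (S i) (S i)) (by tauto)
  refine h2.trans ?_
  have h4 : t ≤ t ^ 2 := by nlinarith
  obtain ⟨s, hs⟩ := Nat.exists_eq_add_of_le h4
  have hs' : t ^ 2 - t = s := by omega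
  rw [hs']
  nlinarith

lemma npts_pair_of_planes (hfr : IsFrame e0 e1 e2 e3) (hg : ∀ a b c d : F,
      g (a • e0 + b • e1 + c • e2 + d • e3) = a * d) :
    IsQuadricSectionSize t (npts fun v => g v = 0 ∧ herm t v v = 0) := by
  obtain ⟨b, rfl, rfl, rfl, rfl⟩ := hfr.exists_basis
  obtain ⟨R, hR⟩ := exists_herm_eq (t := t) (b.coord 0)
  obtain ⟨S, hS⟩ := exists_herm_eq (t := t) (b.coord 3)
  have := npts_two_planes (t := t) (R := R) (S := S) (u := b 0) (w := b 3)
    (by simp [← hR]) (by simp [← hS]) (by simp [← hS]) (by simp [← hR])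
  convert this using 6 with v
  rw [← hR, ← hS, ← mul_eq_zero]
  have hv := b.sum_repr v
  rw [Fin.sum_univ_four] at hv
  conv_lhs => rw [← hv, hg]
  rfl

lemma isQuadricSectionSize_of_frame (hfr : IsFrame e0 e1 e2 e3) {β γ : F} (hg : ∀ a b c d : F,
      g (a • e0 + b • e1 + c • e2 + d • e3) = a * d + (β * (b * c) + γ * c ^ 2)) :
    IsQuadricSectionSize t (npts fun v => g v = 0 ∧ herm t v v = 0) := by
  by_cases hβ : β = 0
  · subst hβ
    by_cases hγ : γ = 0
    · subst hγ
      exact npts_pair_of_planes hfr fun a b c d => by rw [hg]; ring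
    · exact .inr (npts_cone_le hfr hγ fun a b c d => by rw [hg]; ring)
  · refine .inr (npts_hyperbolic_le (e0 := e0) (e1 := e1)
      (e2 := (β⁻¹) • e2 + (-(γ / β ^ 2)) • e1) (e3 := (-1 : F) • e3) (fun v => ?_)
      fun a b c d => ?_)
    · obtain ⟨a, b, c, d, rfl⟩ := hfr v
      refine ⟨a, b + c * γ / β, c * β, -d, ?_⟩
      match_scalars <;> field_simp <;> ring
    · have : a • e0 + b • e1 + c • (β⁻¹ • e2 + (-(γ / β ^ 2)) • e1) + d • (-1 : F) • e3 =
          a • e0 + (b - c * γ / β ^ 2) • e1 + (c / β) • e2 + (-d) • e3 := by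
        match_scalars <;> field_simp <;> ring
      rw [this, hg]
      field_simp
      ring

theorem isQuadricSectionSize_bilin (C : (Fin 4 → F) →ₗ[F] (Fin 4 → F) →ₗ[F] F)
    (hC : ∃ x, C x x ≠ 0) :
    IsQuadricSectionSize t (npts fun v => C v v = 0 ∧ herm t v v = 0) := by
  by_cases hP : ∃ P y, C P P = 0 ∧ herm t P P = 0 ∧ C P y + C y P ≠ 0
  · obtain ⟨P, y, hP, hPP, hy⟩ := hP
    obtain ⟨e0, e1, e2, α, β, γ, hfr, hg⟩ := exists_frame C hP hy
    by_cases hN : ∀ b c : F, α * b ^ 2 + β * (b * c) + γ * c ^ 2 = 0 → b = 0 ∧ c = 0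
    · exact .inr (npts_elliptic_le (g := fun v => C v v) hfr hg hN hPP)
    push Not at hN
    obtain ⟨b₀, c₀, h0, hne⟩ := hN
    by_cases hb : b₀ = 0
    · subst hb
      have hc := hne rfl
      have hγ : γ = 0 := by simpa [hc] using h0
      subst hγ
      refine isQuadricSectionSize_of_frame (g := fun v => C v v) (e0 := e0) (e1 := e2)
        (e2 := e1) (e3 := P) (β := β) (γ := α) (fun v => ?_) fun a b c d => ?_
      · obtain ⟨a, b, c, d, rfl⟩ := hfr v
        exact ⟨a, c, b, d, by abel⟩
      · have := hg a c b d
        rw [add_right_comm (a • e0)] at this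
        simp only [this]
        ring
    · refine isQuadricSectionSize_of_frame (g := fun v => C v v) (e0 := e0)
        (e1 := b₀ • e1 + c₀ • e2) (e2 := e2) (e3 := P) (β := β * b₀ + 2 * γ * c₀) (γ := γ)
        (fun v => ?_) fun a b c d => ?_
      · obtain ⟨a, b, c, d, rfl⟩ := hfr v
        refine ⟨a, b / b₀, c - b / b₀ * c₀, d, ?_⟩
        match_scalars <;> field_simp <;> ring
      · have := hg a (b * b₀) (b * c₀ + c) d
        have e : a • e0 + (b * b₀) • e1 + (b * c₀ + c) • e2 + d • P =
          a • e0 + b • (b₀ • e1 + c₀ • e2) + c • e2 + d • P := by module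
        rw [e] at this
        simp only [this]
        linear_combination b ^ 2 * h0
  · push Not at hP
    right
    let S : Submodule F (Fin 4 → F) :=
      { carrier := {x | C x x = 0 ∧ ∀ y, C x y + C y x = 0}
        zero_mem' := by simp
        add_mem' := by
          rintro x y ⟨hx, hx'⟩ ⟨hy, hy'⟩
          refine ⟨?_, fun z => ?_⟩
          · simp only [map_add, LinearMap.add_apply]
            linear_combination hx + hy + hx' y
          · simp only [map_add, LinearMap.add_apply]
            linear_combination hx' z + hy' z
        smul_mem' := by
          rintro c x ⟨hx, hx'⟩
          refine ⟨by simp [hx], fun z => ?_⟩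
          simp only [map_smul, LinearMap.smul_apply, smul_eq_mul]
          linear_combination c * hx' z }
    have hS : S < ⊤ := by
      obtain ⟨x, hx⟩ := hC
      refine lt_top_iff_ne_top.2 fun h => hx ?_
      have : x ∈ S := h ▸ Submodule.mem_top
      exact this.1
    obtain ⟨φ, hφ, hle⟩ := S.exists_le_ker_of_lt_top hS
    obtain ⟨R, hR⟩ := exists_herm_eq (t := t) φ
    have hR0 : R ≠ 0 := by
      rintro rfl
      exact hφ (LinearMap.ext fun v => by simp [hR])
    refine (npts_mono fun v _ hv => ?_).trans ((npts_plane_le (t := t) hR0).trans ?_)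
    · refine ⟨?_, hv.2⟩
      rw [← hR]
      exact hle (show v ∈ S from ⟨hv.1, fun y => hP v y hv.1 hv.2⟩)
    · omega

omit [Fintype F] hF in
lemma exists_bilin_of_isHomogeneous (f : MvPolynomial (Fin 4) F) (hf : f.IsHomogeneous 2) :
    ∃ C : (Fin 4 → F) →ₗ[F] (Fin 4 → F) →ₗ[F] F, ∀ x, MvPolynomial.eval x f = C x x := by
  have key : ∀ d ∈ f.support, ∃ C : (Fin 4 → F) →ₗ[F] (Fin 4 → F) →ₗ[F] F,
      ∀ x, MvPolynomial.eval x (MvPolynomial.monomial d (f.coeff d)) = C x x := fun d hd => by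
    have h := hf (MvPolynomial.mem_support_iff.1 hd)
    replace h : d.degree = 2 := by rwa [Finsupp.degree_eq_weight_one]
    obtain ⟨i, j, rfl⟩ : ∃ i j, d = Finsupp.single i 1 + Finsupp.single j 1 := by
      have h2 : Multiset.card (Finsupp.toMultiset d) = 2 := by
        rw [Finsupp.card_toMultiset]; exact h
      obtain ⟨i, j, hij⟩ := Multiset.card_eq_two.1 h2
      refine ⟨i, j, ?_⟩
      rw [← Finsupp.toMultiset_toFinsupp d, hij, Multiset.insert_eq_cons, ← Multiset.singleton_add,
        map_add, Multiset.toFinsupp_singleton, Multiset.toFinsupp_singleton]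
    refine ⟨f.coeff (Finsupp.single i 1 + Finsupp.single j 1) •
      (LinearMap.mul F F).compl₁₂ (LinearMap.proj i) (LinearMap.proj j), fun x => ?_⟩
    rw [MvPolynomial.eval_monomial, Finsupp.prod_add_index' (by simp) (by simp [pow_add])]
    simp
  choose! C hC using key
  refine ⟨∑ d ∈ f.support, C d, fun x => ?_⟩
  conv_lhs => rw [f.as_sum, map_sum, sum_congr rfl fun d hd => hC d hd x]
  simp [LinearMap.sum_apply]

end Quadrics

/-- Sørensen's conjecture for `h = 2`: for every quadric `Q = Z(f)` in `PG(3,t²)`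
and the non-degenerate Hermitian surface `X`, either `|Q ∩ X| = 2(t³+t²-t)+t+1`
or `|Q ∩ X| ≤ 2t³+t²+1`; in particular `|Q ∩ X| ≤ 2(t³+t²-t)+t+1`. -/
theorem sorensen_conjecture_quadrics (t : ℕ) (ht : IsPrimePow t)
    (F : Type) [Field F] [Fintype F] (hF : Fintype.card F = t ^ 2)
    (f : MvPolynomial (Fin 4) F) (hf : f.IsHomogeneous 2) (hf0 : f ≠ 0)
    (Q : Set (ℙ F (Fin 4 → F))) (hQ : Q = {x | MvPolynomial.eval x.rep f = 0}) :
    (Nat.card ↥(Q ∩ hermSurf t F) = 2 * (t ^ 3 + t ^ 2 - t) + t + 1 ∨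
      Nat.card ↥(Q ∩ hermSurf t F) ≤ 2 * t ^ 3 + t ^ 2 + 1) ∧
    Nat.card ↥(Q ∩ hermSurf t F) ≤ 2 * (t ^ 3 + t ^ 2 - t) + t + 1 := by
  have hH := isHermitianField_of_isPrimePow ht hF
  have ht2 := ht.two_le
  obtain ⟨C, hC⟩ := exists_bilin_of_isHomogeneous f hf
  have hC0 : ∃ x, C x x ≠ 0 := by
    by_contra! h
    refine hf0 (MvPolynomial.eq_zero_of_eval_eq_zero _ _ f (fun v => by rw [hC, h]) ?_)
    rw [MvPolynomial.mem_restrictDegree]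
    intro s hs i
    have h4 : 4 ≤ t ^ 2 := by nlinarith
    have hd := hf (MvPolynomial.mem_support_iff.1 hs)
    have h1 : s i ≤ 2 := by
      rw [← hd]
      simpa [Finsupp.weight_apply, Finsupp.sum_fintype] using
        single_le_sum (f := fun j => s j) (fun _ _ => Nat.zero_le _) (mem_univ i)
    omega
  have key := isQuadricSectionSize_bilin (t := t) C hC0
  have hset : Nat.card ↥(Q ∩ hermSurf t F) =
      npts fun v => C v v = 0 ∧ herm t v v = 0 := by
    rw [Nat.card_coe_set_eq, npts, hQ]
    congr 1
    ext x
    simp [hermSurf, hC, herm_self_eq]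
  rw [hset]
  refine ⟨key, key.elim le_of_eq fun h => h.trans ?_⟩
  have : t ≤ t ^ 2 := by nlinarith
  have : 1 ≤ t ^ 3 := Nat.one_le_pow _ _ (by omega)
  omega
end
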